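/- arXiv:1601.02202 — 2 statements merged into one kernel-verified Lean document; each statement's English description precedes it below -/
import Mathlib

section
/- Let β > 1. Then for Lebesgue-almost all x ∈ [0,1), lim_{n→∞} k_n(x)/n = 6·log 2·log β/π². -/
open MeasureTheory Filter Set

/-- The β-transformation `T_β x = βx - ⌊βx⌋` on `[0,1)`. -/
noncomputable def betaT (β : ℝ) (x : ℝ) : ℝ := β * x - ⌊β * x⌋

/-- The `i`-th digit (for `i ≥ 1`) of the β-expansion of `x`. -/
noncomputable def betaEps (β : ℝ) (i : ℕ) (x : ℝ) : ℤ := ⌊β * (betaT β)^[i - 1] x⌋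

/-- The cylinder of order `n` of the β-expansion containing `x`. -/
def betaCyl (β : ℝ) (n : ℕ) (x : ℝ) : Set ℝ :=
  {y ∈ Set.Ico (0:ℝ) 1 | ∀ i, 1 ≤ i → i ≤ n → betaEps β i y = betaEps β i x}

/-- The Gauss map, with `T 0 = 0`. -/
noncomputable def gaussMap (x : ℝ) : ℝ := if x = 0 then 0 else 1 / x - ⌊1 / x⌋

/-- The `i`-th partial quotient (for `i ≥ 1`) of the continued fraction expansion of `x`. -/
noncomputable def cfA (i : ℕ) (x : ℝ) : ℤ := ⌊1 / (gaussMap^[i - 1] x)⌋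

/-- The cylinder of order `m` of the continued fraction expansion containing `x`. -/
def cfCyl (m : ℕ) (x : ℝ) : Set ℝ :=
  {y ∈ Set.Ico (0:ℝ) 1 | ∀ i, 1 ≤ i → i ≤ m → cfA i y = cfA i x}

/-- `k_n(x)`: the exact number of partial quotients of the continued fraction of `x`
determined by the first `n` β-expansion digits of `x`. -/
noncomputable def kCF (β : ℝ) (n : ℕ) (x : ℝ) : ℕ :=
  sSup {m | betaCyl β n x ⊆ cfCyl m x}

/-- Denominators `q_n(x)` of the continued fraction convergents of `x`
(`q_0 = 1`, `q_1 = a_1`, `q_n = a_n q_{n-1} + q_{n-2}`). -/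
noncomputable def cfQ (x : ℝ) : ℕ → ℤ
  | 0 => 1
  | 1 => cfA 1 x
  | (n + 2) => cfA (n + 2) x * cfQ x (n + 1) + cfQ x n

/-- Numerators `p_n(x)` of the continued fraction convergents of `x`
(`p_0 = 0`, `p_1 = 1`, `p_n = a_n p_{n-1} + p_{n-2}`). -/
noncomputable def cfP (x : ℝ) : ℕ → ℤ
  | 0 => 0
  | 1 => 1
  | (n + 2) => cfA (n + 2) x * cfP x (n + 1) + cfP x n

/-- `l_n(x)`: the length of the longest string of zeros just after the `n`-th digit
of the β-expansion of `x`. -/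
noncomputable def lZero (β : ℝ) (n : ℕ) (x : ℝ) : ℕ :=
  sSup {k | ∀ j, 1 ≤ j → j ≤ k → betaEps β (n + j) x = 0}


namespace KN

lemma gauss_mem (x : ℝ) : gaussMap x ∈ Ico (0:ℝ) 1 := by
  unfold gaussMap
  split_ifs
  · simp
  · exact ⟨by linarith [Int.floor_le (1/x)], by linarith [Int.lt_floor_add_one (1/x)]⟩

lemma gauss_iter_mem (x : ℝ) (hx : x ∈ Ico (0:ℝ) 1) (n : ℕ) : gaussMap^[n] x ∈ Ico (0:ℝ) 1 := by
  induction n with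
  | zero => exact hx
  | succ n _ => rw [Function.iterate_succ_apply']; exact gauss_mem _

lemma gauss_irr (x : ℝ) (hx : Irrational x) : Irrational (gaussMap x) := by
  unfold gaussMap
  rw [if_neg hx.ne_zero, one_div]
  exact (irrational_inv_iff.2 hx).sub_intCast _

lemma gauss_iter_irr (x : ℝ) (hx : Irrational x) (n : ℕ) : Irrational (gaussMap^[n] x) := by
  induction n with
  | zero => exact hx
  | succ n ih => rw [Function.iterate_succ_apply']; exact gauss_irr _ ih

lemma gauss_eq (x : ℝ) (hx : x ≠ 0) : 1 / x = ⌊1 / x⌋ + gaussMap x := by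
  unfold gaussMap; rw [if_neg hx]; ring

lemma floor_ge (x : ℝ) (hx : x ∈ Ico (0:ℝ) 1) (h0 : x ≠ 0) : (1:ℝ) ≤ ⌊1 / x⌋ := by
  have : 0 < x := lt_of_le_of_ne hx.1 (Ne.symm h0)
  have : (1:ℤ) ≤ ⌊1 / x⌋ := by
    rw [Int.le_floor]; push_cast; rw [le_div_iff₀ this]; linarith [hx.2]
  exact_mod_cast this

/-- product of the orbit -/
noncomputable def P (x : ℝ) (n : ℕ) : ℝ := ∏ i ∈ Finset.range n, gaussMap^[i] x

lemma P_succ (x : ℝ) (n : ℕ) : P x (n+1) = P x n * gaussMap^[n] x := by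
  unfold P; rw [Finset.prod_range_succ]

lemma P_pos (x : ℝ) (h : ∀ i, 0 < gaussMap^[i] x) (n : ℕ) : 0 < P x n := by
  unfold P; exact Finset.prod_pos fun i _ => h i

lemma P_anti (x : ℝ) (hx : x ∈ Ico (0:ℝ) 1) (h : ∀ i, 0 < gaussMap^[i] x) : Antitone (P x) := by
  apply antitone_nat_of_succ_le
  intro n
  rw [P_succ]
  have := P_pos x h n
  have := (gauss_iter_mem x hx n).2
  nlinarith

/-- same digits up to j, then the orbit of y doesn't vanish before j -/
lemma orbit_pos (x y : ℝ) (hx : x ∈ Ico (0:ℝ) 1) (hy : y ∈ Ico (0:ℝ) 1)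
    (h : ∀ i, 0 < gaussMap^[i] x) (i : ℕ) 
    (hd : cfA (i+1) y = cfA (i+1) x) : 0 < gaussMap^[i] y := by
  rcases (gauss_iter_mem y hy i).1.lt_or_eq with h1 | h1
  · exact h1
  · exfalso
    have := floor_ge _ (gauss_iter_mem x hx i) (h i).ne'
    simp only [cfA, Nat.add_sub_cancel] at hd
    rw [← hd, ← h1] at this
    norm_num at this

lemma diff_eq (x y : ℝ) (hx : x ∈ Ico (0:ℝ) 1) (hy : y ∈ Ico (0:ℝ) 1)
    (h : ∀ i, 0 < gaussMap^[i] x) (j : ℕ) 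
    (hd : ∀ i < j, cfA (i+1) y = cfA (i+1) x) :
    |x - y| = |gaussMap^[j] x - gaussMap^[j] y| * (P x j * P y j) ∧
    0 < P y j ∧
    ∃ q q' : ℝ, 0 ≤ q' ∧ q' ≤ q ∧ 0 < q ∧ P x j * (q + gaussMap^[j] x * q') = 1
      ∧ P y j * (q + gaussMap^[j] y * q') = 1 := by
  induction j with
  | zero => 
    refine ⟨by simp [P], by simp [P], 1, 0, ?_⟩
    simp [P]
  | succ j ih =>
    obtain ⟨h1, h2, q, q', h3, h4, h5, h6, h7⟩ := ih (fun i hi => hd i (by omega))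
    have hyp := orbit_pos x y hx hy h j (hd j (by omega))
    have hxp := h j
    have ex := gauss_eq _ hxp.ne'
    have ey := gauss_eq _ hyp.ne'
    have hdj := hd j (by omega)
    simp only [cfA, Nat.add_sub_cancel] at hdj
    have ha := floor_ge _ (gauss_iter_mem x hx j) hxp.ne'
    rw [hdj] at ey
    rw [← Function.iterate_succ_apply' gaussMap] at ex ey
    rw [P_succ, P_succ]
    set t := gaussMap^[j] x
    set s := gaussMap^[j] y
    set t' := gaussMap^[j+1] x
    set s' := gaussMap^[j+1] y
    set a : ℝ := (⌊1/t⌋ : ℝ)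
    have ex' : 1 = (a + t') * t := by rw [← ex]; field_simp
    have ey' : 1 = (a + s') * s := by rw [← ey]; field_simp
    refine ⟨?_, mul_pos h2 hyp, a * q + q', q, h5.le, by nlinarith, by nlinarith, ?_, ?_⟩
    · have : t - s = - (t' - s') * (t * s) := by
        linear_combination t * ey' - s * ex'
      rw [h1, this, abs_mul, abs_neg, abs_of_pos (mul_pos hxp hyp)]; ring
    · rw [← h6]; linear_combination (- P x j * q) * ex'
    · rw [← h7]; linear_combination (- P y j * q) * ey'

lemma compar (x y : ℝ) (hx : x ∈ Ico (0:ℝ) 1) (hy : y ∈ Ico (0:ℝ) 1)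
    (h : ∀ i, 0 < gaussMap^[i] x) (j : ℕ) 
    (hd : ∀ i < j, cfA (i+1) y = cfA (i+1) x) :
    P y j ≤ 2 * P x j ∧ P x j ≤ 2 * P y j := by
  obtain ⟨_, h2, q, q', h3, h4, h5, h6, h7⟩ := diff_eq x y hx hy h j hd
  have h1 := P_pos x h j
  have a := gauss_iter_mem x hx j
  have b := gauss_iter_mem y hy j
  have key : ∀ A B t s : ℝ, 0 < A → 0 < B → t ∈ Ico (0:ℝ) 1 → s ∈ Ico (0:ℝ) 1 → 
      A * (q + t * q') = 1 → B * (q + s * q') = 1 → A ≤ 2 * B := by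
    intro A B t s hA hB ht hs e1 e2
    have f1 : A * q ≤ 1 := by
      have := mul_nonneg hA.le (mul_nonneg ht.1 h3)
      nlinarith
    have f2 : 1 ≤ 2 * B * q := by
      have : s * q' ≤ q := by nlinarith [hs.1, hs.2]
      nlinarith
    by_contra hc
    push Not at hc
    nlinarith
  exact ⟨key _ _ _ _ h2 h1 b a h7 h6, key _ _ _ _ h1 h2 a b h6 h7⟩

lemma cyl_upper (x y : ℝ) (hx : x ∈ Ico (0:ℝ) 1) 
    (h : ∀ i, 0 < gaussMap^[i] x) (m : ℕ) (hy : y ∈ cfCyl m x) :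
    |x - y| ≤ 2 * (P x m)^2 := by
  have hd : ∀ i < m, cfA (i+1) y = cfA (i+1) x := fun i hi => hy.2 (i+1) (by omega) (by omega)
  have e := (diff_eq x y hx hy.1 h m hd).1
  have c := (compar x y hx hy.1 h m hd).1
  have h2 := (diff_eq x y hx hy.1 h m hd).2.1
  have h1 := P_pos x h m
  have a := gauss_iter_mem x hx m
  have b := gauss_iter_mem y hy.1 m
  have : |gaussMap^[m] x - gaussMap^[m] y| ≤ 1 := by
    rw [abs_le]; constructor <;> linarith [a.1, a.2, b.1, b.2]
  rw [e]
  calc _ ≤ 1 * (P x m * P y m) := by gcongr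
    _ ≤ 1 * (P x m * (2 * P x m)) := by gcongr
    _ = _ := by ring

lemma key_real (t s t' t'' b : ℝ) (a : ℤ) (ht : 0 < t) (hs : 0 ≤ s) (p1 : 0 < t') (p2 : 0 < t'')
    (ht1 : t' < 1) (ht2 : t'' < 1) (ha : (1:ℝ) ≤ a) (hb : 1 ≤ b) (e1 : 1 = (a + t') * t)
    (e2 : 1 = (b + t'') * t') (hne : ⌊1 / s⌋ ≠ a) : t^2 * (t' * t'') / 4 ≤ |t - s| := by
  have q1 := mul_pos p1 p2
  have l1 : t' * t'' / 2 ≤ 1 - t' := by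
    have : t' * t'' ≤ 1 - t' := by nlinarith
    linarith
  have l2 : t' * t'' / 2 ≤ t' := by nlinarith
  have q2 := mul_pos p1 ht
  by_cases hsmall : s * (a + 1) ≤ 1
  · have : t^2 * (t' * t'') / 4 ≤ t - s := by
      have g1 : (1 - t') * t ≤ (t - s) * (a + 1) := by linarith
      have g2 : (a+1) * t ≤ 2 := by nlinarith
      have g0 : 0 ≤ (1 - t') * t := mul_nonneg (by linarith) ht.le
      have hts : 0 ≤ t - s := by
        by_contra hneg
        push Not at hneg
        nlinarith
      have g5 : (1 - t') * t * t ≤ (t - s) * (a + 1) * t := by gcongr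
      have g3 : (t - s) * ((a + 1) * t) ≤ (t - s) * 2 := by gcongr
      have g4 : t' * t'' / 2 * (t * t) ≤ (1 - t') * (t * t) := by gcongr
      linarith
    exact this.trans (le_abs_self _)
  · push Not at hsmall
    have s0 : 0 < s := by
      rcases hs.lt_or_eq with h' | h'
      · exact h'
      · rw [← h'] at hsmall; norm_num at hsmall
    have hbig : 1 < s * a := by
      by_contra hcon
      push Not at hcon
      apply hne
      rw [Int.floor_eq_iff]
      constructor
      · rw [le_div_iff₀ s0]; linarith
      · rw [div_lt_iff₀ s0]; linarith
    have : t^2 * (t' * t'') / 4 ≤ s - t := by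
      have g1 : t' * t ≤ (s - t) * a := by linarith
      have g2 : a * t ≤ 1 := by linarith
      have hts : 0 ≤ s - t := by
        by_contra hneg
        push Not at hneg
        nlinarith
      have g3 : t' * t * t ≤ (s - t) * a * t := by gcongr
      have g4 : (s - t) * (a * t) ≤ (s - t) * 1 := by gcongr
      have g5 : t' * t'' / 2 * (t * t) ≤ t' * (t * t) := by gcongr
      have := mul_pos q2 ht
      linarith
    rw [abs_sub_comm]
    exact this.trans (le_abs_self _)

lemma cyl_lower (x y : ℝ) (hx : x ∈ Ico (0:ℝ) 1) (hy : y ∈ Ico (0:ℝ) 1)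
    (h : ∀ i, 0 < gaussMap^[i] x) (m : ℕ) (hxy : |x - y| < (P x (m+2))^2 / 8) :
    y ∈ cfCyl m x := by
  by_contra hc
  have hex : ∃ j, j < m ∧ cfA (j+1) y ≠ cfA (j+1) x := by
    by_contra hne
    push Not at hne
    apply hc
    refine ⟨hy, fun i h1 h2 => ?_⟩
    have := hne (i-1) (by omega)
    rwa [Nat.sub_add_cancel h1] at this
  classical
  obtain ⟨hj, hne⟩ := Nat.find_spec hex
  have hmin := fun i (hi : i < Nat.find hex) => Nat.find_min hex hi
  set j := Nat.find hex
  have hd : ∀ i < j, cfA (i+1) y = cfA (i+1) x := by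
    intro i hi
    by_contra h'
    exact hmin i hi ⟨by omega, h'⟩
  obtain ⟨e, hp, -⟩ := diff_eq x y hx hy h j hd
  have c := (compar x y hx hy h j hd).2
  have hPm := P_anti x hx h (show j + 3 ≤ m + 2 by omega)
  have hP1 := P_pos x h (m+2)
  have hPj := P_pos x h j
  have ht := h j
  have ht1 := gauss_iter_mem x hx (j+1)
  have ht2 := gauss_iter_mem x hx (j+2)
  have hs := gauss_iter_mem y hy j
  have p1 := h (j+1)
  have p2 := h (j+2)
  rw [P_succ x (j+2), P_succ x (j+1), P_succ x j] at hPm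
  have ex := gauss_eq _ ht.ne'
  have ex2 := gauss_eq _ (h (j+1)).ne'
  rw [← Function.iterate_succ_apply' gaussMap] at ex ex2
  have ha := floor_ge _ (gauss_iter_mem x hx j) ht.ne'
  have hb := floor_ge _ (gauss_iter_mem x hx (j+1)) p1.ne'
  simp only [cfA, Nat.add_sub_cancel] at hne
  have htl := (gauss_iter_mem x hx j).2
  change 1 / gaussMap^[j+1] x = _ + gaussMap^[j+2] x at ex2
  set t := gaussMap^[j] x
  set s := gaussMap^[j] y
  set t' := gaussMap^[j+1] x
  set t'' := gaussMap^[j+2] x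
  set a : ℤ := ⌊1/t⌋
  set b : ℝ := (⌊1/t'⌋ : ℝ)
  have e1 : 1 = (a + t') * t := by rw [← ex]; field_simp
  have e2 : 1 = (b + t'') * t' := by rw [← ex2]; field_simp
  have key : t^2 * (t' * t'') / 4 ≤ |t - s| :=
    key_real t s t' t'' b a ht hs.1 p1 p2 ht1.2 ht2.2 ha hb e1 e2 hne
  have : (P x (m+2))^2 / 8 ≤ |x - y| := by
    calc (P x (m+2))^2 / 8 ≤ (P x j * t * t' * t'')^2 / 8 := by gcongr
      _ = (t^2 * (t' * t'') / 4) * (P x j * (P x j / 2)) * (t' * t'') := by ring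
      _ ≤ (t^2 * (t' * t'') / 4) * (P x j * (P x j / 2)) * 1 := by
          gcongr
          nlinarith [ht1.2, ht2.2]
      _ ≤ |t - s| * (P x j * P y j) := by
          rw [mul_one]
          gcongr
          linarith
      _ = _ := e.symm
  linarith

/-! β part -/

lemma beta_mem (β x : ℝ) : betaT β x ∈ Ico (0:ℝ) 1 := by
  unfold betaT
  exact ⟨by linarith [Int.floor_le (β * x)], by linarith [Int.lt_floor_add_one (β * x)]⟩

lemma beta_iter_mem (β x : ℝ) (hx : x ∈ Ico (0:ℝ) 1) (n : ℕ) : (betaT β)^[n] x ∈ Ico (0:ℝ) 1 := by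
  cases n with
  | zero => exact hx
  | succ n => rw [Function.iterate_succ_apply']; exact beta_mem _ _

lemma beta_diff (β x y : ℝ) (n : ℕ) 
    (hd : ∀ i < n, betaEps β (i+1) y = betaEps β (i+1) x) :
    (betaT β)^[n] x - (betaT β)^[n] y = β^n * (x - y) := by
  induction n with
  | zero => simp
  | succ n ih =>
    have := hd n (by omega)
    simp only [betaEps, Nat.add_sub_cancel] at this
    rw [Function.iterate_succ_apply', Function.iterate_succ_apply']
    unfold betaT at *
    rw [this, pow_succ]
    have := ih (fun i hi => hd i (by omega))
    linear_combination β * this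

lemma betaCyl_small (β x y : ℝ) (hβ : 1 < β) (hx : x ∈ Ico (0:ℝ) 1) (n : ℕ) (hy : y ∈ betaCyl β n x) :
    |x - y| < 1 / β^n := by
  have e := beta_diff β x y n (fun i hi => hy.2 (i+1) (by omega) (by omega))
  have a := beta_iter_mem β x hx n
  have b := beta_iter_mem β y hy.1 n
  have hp : 0 < β^n := by positivity
  have : |β^n * (x-y)| < 1 := by
    rw [← e, abs_lt]; constructor <;> linarith [a.1, a.2, b.1, b.2]
  rw [abs_mul, abs_of_pos hp] at this
  rw [lt_div_iff₀ hp]; linarith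

lemma betaCyl_left (β : ℝ) (hβ : 1 < β) (n : ℕ) : ∀ (x : ℝ) (hx : x ∈ Ico (0:ℝ) 1), 
    x - (betaT β)^[n] x / β^n ∈ betaCyl β n x := by
  induction n with
  | zero => 
    intro x hx
    refine ⟨by simp, fun i h1 h2 => by omega⟩
  | succ n ih =>
    intro x hx
    obtain ⟨h1, h2⟩ := ih (betaT β x) (beta_mem β x)
    have hp : 0 < β^n := by positivity
    have hm := (beta_iter_mem β (betaT β x) (beta_mem β x) n).1
    rw [Function.iterate_succ_apply]
    set u := betaT β x - (betaT β)^[n] (betaT β x) / β^n with hu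
    set w := x - (betaT β)^[n] (betaT β x) / β^(n+1) with hw
    have hul : u ≤ betaT β x := by
      rw [hu]; have := div_nonneg hm hp.le; linarith
    have e : β * w = ⌊β * x⌋ + u := by
      rw [hu, hw, pow_succ]; unfold betaT; field_simp; ring
    have ef : ⌊β * w⌋ = ⌊β * x⌋ := by
      rw [e, Int.floor_eq_iff]; constructor
      · linarith [h1.1]
      · linarith [h1.2]
    have eT : betaT β w = u := by
      unfold betaT; rw [ef, e]; ring
    have hf : (0:ℝ) ≤ ⌊β * x⌋ := by
      have : (0:ℤ) ≤ ⌊β * x⌋ := by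
        rw [Int.floor_nonneg]; exact mul_nonneg (by linarith) hx.1
      exact_mod_cast this
    refine ⟨⟨?_, ?_⟩, ?_⟩
    · by_contra hneg
      push Not at hneg
      nlinarith [h1.1]
    · have : w ≤ x := by
        rw [hw]; have := div_nonneg hm (pow_pos (show 0 < β by linarith) (n+1)).le; linarith
      linarith [hx.2]
    · intro i hi1 hi2
      rcases i with _ | _ | i
      · omega
      · simp only [betaEps]; simpa using ef
      · have := h2 (i+1) (by omega) (by omega)
        simp only [betaEps, Nat.add_sub_cancel] at this ⊢
        rw [Function.iterate_succ_apply, Function.iterate_succ_apply, eT]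
        exact this

end KN

namespace KN

open Topology in
lemma final_limit (β : ℝ) (hβ : 1 < β) (x : ℝ) (hx : x ∈ Ico (0:ℝ) 1) (hirr : Irrational x)
    (c : ℝ) (hc : 0 < c) (hS : Tendsto (fun m : ℕ => - Real.log (P x m) / m) atTop (𝓝 c))
    (hT : ∀ᶠ n : ℕ in atTop, 1 / ((n:ℝ)+1)^3 ≤ (betaT β)^[n] x) :
    Tendsto (fun n : ℕ => (kCF β n x : ℝ) / n) atTop (𝓝 (Real.log β / (2 * c))) := by
  have h : ∀ i, 0 < gaussMap^[i] x := fun i =>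
    lt_of_le_of_ne (gauss_iter_mem x hx i).1 (gauss_iter_irr x hirr i).ne_zero.symm
  have hPp := P_pos x h
  have hPa := P_anti x hx h
  have hlβ : 0 < Real.log β := Real.log_pos hβ
  set S : ℕ → ℝ := fun m => - Real.log (P x m) with hSdef
  have hSm : Monotone S := by
    intro a b hab
    exact neg_le_neg (Real.log_le_log (hPp b) (hPa hab))
  have hStop : Tendsto S atTop atTop := by
    have h1 := Tendsto.pos_mul_atTop hc hS (tendsto_natCast_atTop_atTop (R := ℝ))
    refine h1.congr' ?_
    filter_upwards [eventually_gt_atTop 0] with m hm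
    have : (m:ℝ) ≠ 0 := by positivity
    simp only [hSdef]; field_simp
  have up : ∀ᶠ n : ℕ in atTop, ∀ m, betaCyl β n x ⊆ cfCyl m x → 
      2 * S m ≤ n * Real.log β + 3 * Real.log (n+1) + Real.log 2 := by
    filter_upwards [hT] with n hn m hm
    have h1 := cyl_upper x _ hx h m (hm (betaCyl_left β hβ n x hx))
    have hbp : 0 < β^n := by positivity
    have hTp : 0 < (betaT β)^[n] x := lt_of_lt_of_le (by positivity) hn
    rw [sub_sub_cancel, abs_of_pos (div_pos hTp hbp)] at h1
    have h2 : 1 / ((n:ℝ)+1)^3 / β^n ≤ 2 * P x m ^ 2 := le_trans (by gcongr) h1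
    have h3 := Real.log_le_log (by positivity) h2
    rw [Real.log_div (by positivity) (by positivity), Real.log_div (by positivity) (by positivity),
      Real.log_mul (by positivity) (by have := hPp m; positivity), Real.log_pow, Real.log_pow, Real.log_pow,
      Real.log_one] at h3
    simp only [hSdef]
    push_cast at h3
    linarith
  have lo : ∀ n m : ℕ, ¬ (betaCyl β n x ⊆ cfCyl m x) → n * Real.log β ≤ 2 * S (m + 2) + Real.log 8 := by
    intro n m hm
    obtain ⟨y, hy, hym⟩ := Set.not_subset.1 hm
    have h1 : (P x (m+2))^2 / 8 ≤ |x - y| := by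
      by_contra hcon
      push Not at hcon
      exact hym (cyl_lower x y hx hy.1 h m hcon)
    have h2 := h1.trans (betaCyl_small β x y hβ hx n hy).le
    have hp := hPp (m+2)
    have hbp : 0 < β^n := by positivity
    have h3 := Real.log_le_log (by positivity) h2
    rw [Real.log_div (by positivity) (by positivity), Real.log_div (by positivity) (by positivity),
      Real.log_pow, Real.log_pow, Real.log_one] at h3
    simp only [hSdef]
    push_cast at h3
    linarith
  have both : ∀ᶠ n : ℕ in atTop, 
      2 * S (kCF β n x) ≤ n * Real.log β + 3 * Real.log (n+1) + Real.log 2 ∧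
      n * Real.log β ≤ 2 * S (kCF β n x + 3) + Real.log 8 := by
    filter_upwards [up] with n hn
    have hbdd : BddAbove {m | betaCyl β n x ⊆ cfCyl m x} := by
      obtain ⟨M, hM⟩ := (hStop.eventually_gt_atTop
        ((n * Real.log β + 3 * Real.log (n+1) + Real.log 2)/2)).exists
      refine ⟨M, fun m hm => ?_⟩
      by_contra hcon
      push Not at hcon
      have := hn m hm
      have := hSm hcon.le
      linarith
    have hne : {m | betaCyl β n x ⊆ cfCyl m x}.Nonempty := 
      ⟨0, fun y hy => ⟨hy.1, fun i h1 h2 => by omega⟩⟩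
    refine ⟨hn _ (Nat.sSup_mem hne hbdd), ?_⟩
    apply lo n (kCF β n x + 1)
    intro hcon
    have : kCF β n x + 1 ≤ kCF β n x := le_csSup hbdd hcon
    omega
  have hk : Tendsto (fun n => kCF β n x) atTop atTop := by
    rw [tendsto_atTop]
    intro M
    have : Tendsto (fun n : ℕ => (n:ℝ) * Real.log β) atTop atTop :=
      tendsto_natCast_atTop_atTop.atTop_mul_const hlβ
    filter_upwards [both, this.eventually_gt_atTop (2 * S (M+3) + Real.log 8)] with n h1 h2
    by_contra hcon
    push Not at hcon
    have := hSm (show kCF β n x + 3 ≤ M + 3 by omega)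
    linarith [h1.2]
  have hkr : Tendsto (fun n => (kCF β n x : ℝ)) atTop atTop := tendsto_natCast_atTop_atTop.comp hk
  have hA : Tendsto (fun n => 2 * (S (kCF β n x) / (kCF β n x : ℝ))) atTop (𝓝 (2 * c)) :=
    (hS.comp hk).const_mul 2
  have hB : Tendsto (fun n => (2 * S (kCF β n x + 3) + Real.log 8) / (kCF β n x : ℝ)) atTop (𝓝 (2 * c)) := by
    have a1 : Tendsto (fun m : ℕ => S (m+3) / ((m+3 : ℕ):ℝ)) atTop (𝓝 c) :=
      hS.comp (tendsto_add_atTop_nat 3)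
    have a2 : Tendsto (fun m : ℕ => 1 + (3:ℝ) / (m:ℝ)) atTop (𝓝 (1 + 0)) :=
      tendsto_const_nhds.add (tendsto_const_div_atTop_nhds_zero_nat 3)
    have a3 : Tendsto (fun m : ℕ => Real.log 8 / (m:ℝ)) atTop (𝓝 0) :=
      tendsto_const_div_atTop_nhds_zero_nat _
    have a4 := ((a1.mul a2).const_mul 2).add a3
    have a5 : Tendsto (fun m : ℕ => (2 * S (m + 3) + Real.log 8) / (m : ℝ)) atTop (𝓝 (2 * c)) := by
      have e : 2 * (c * (1 + 0)) + 0 = 2 * c := by ring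
      rw [e] at a4
      refine a4.congr' ?_
      filter_upwards [eventually_gt_atTop 0] with m hm
      have : (0:ℝ) < m := by exact_mod_cast hm
      push_cast
      field_simp
    exact a5.comp hk
  have hD : Tendsto (fun n : ℕ => (n * Real.log β + 3 * Real.log (n+1) + Real.log 2) / (n:ℝ)) atTop
      (𝓝 (Real.log β)) := by
    have a3 : Tendsto (fun m : ℕ => Real.log 2 / (m:ℝ)) atTop (𝓝 0) :=
      tendsto_const_div_atTop_nhds_zero_nat _
    have a1 : Tendsto (fun m : ℕ => Real.log ((m:ℝ)+1) / ((m:ℝ))) atTop (𝓝 0) := by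
      have b1 : Tendsto (fun y : ℝ => Real.log y / (1 * y + (-1))) atTop (𝓝 0) := by
        have := Real.tendsto_pow_log_div_mul_add_atTop 1 (-1) 1 one_ne_zero
        simpa using this
      have b2 : Tendsto (fun m : ℕ => (m:ℝ) + 1) atTop atTop :=
        tendsto_atTop_add_const_right _ _ tendsto_natCast_atTop_atTop
      refine (b1.comp b2).congr fun m => ?_
      simp
    have a4 := ((tendsto_const_nhds (x := Real.log β) (f := (atTop : Filter ℕ))).add (a1.const_mul 3)).add a3
    have e : Real.log β + 3 * 0 + 0 = Real.log β := by ring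
    rw [e] at a4
    refine a4.congr' ?_
    filter_upwards [eventually_gt_atTop 0] with m hm
    have : (0:ℝ) < m := by exact_mod_cast hm
    field_simp
  have hc2 : 2 * c ≠ 0 := by positivity
  refine tendsto_of_tendsto_of_tendsto_of_le_of_le'
    (tendsto_const_nhds.div hB hc2) (hD.div hA hc2) ?_ ?_
  · filter_upwards [both, hkr.eventually_gt_atTop 0, eventually_gt_atTop 0, 
      hB.eventually_const_lt (show 0 < 2 * c by positivity)] with n h1 h2 h3 h4
    have h3' : (0:ℝ) < n := by exact_mod_cast h3
    rw [Pi.div_apply, div_le_div_iff₀ h4 h3']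
    have : (kCF β n x : ℝ) * ((2 * S (kCF β n x + 3) + Real.log 8) / (kCF β n x : ℝ)) =
      2 * S (kCF β n x + 3) + Real.log 8 := by field_simp
    rw [this]; linarith [h1.2]
  · filter_upwards [both, hkr.eventually_gt_atTop 0, eventually_gt_atTop 0, 
      hA.eventually_const_lt (show 0 < 2 * c by positivity)] with n h1 h2 h3 h4
    have h3' : (0:ℝ) < n := by exact_mod_cast h3
    rw [Pi.div_apply, div_le_div_iff₀ h3' h4]
    have e1 : (kCF β n x : ℝ) * (2 * (S (kCF β n x) / (kCF β n x : ℝ))) = 2 * S (kCF β n x) := by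
      field_simp
    have e2 : (n * Real.log β + 3 * Real.log (n+1) + Real.log 2) / (n:ℝ) * n = 
      n * Real.log β + 3 * Real.log (n+1) + Real.log 2 := by field_simp
    rw [e1, e2]; exact h1.1

end KN

namespace KN

open scoped ENNReal

lemma branch (φ φ' : ℕ → ℝ → ℝ) (T : ℝ → ℝ) (N : ℝ → ℕ) (D : Set ℝ)
    (hT : ∀ k, ∀ x ∈ Ico (0:ℝ) 1, T (φ k x) = x)
    (hN : ∀ k, ∀ x ∈ Ico (0:ℝ) 1, N (φ k x) = k)
    (hd : ∀ k, ∀ x ∈ Ico (0:ℝ) 1, HasDerivAt (φ k) (φ' k x) x)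
    (hD : ∀ y ∈ D, ∃ k, ∃ x ∈ Ico (0:ℝ) 1, φ k x = y)
    (hD' : ∀ k, ∀ x ∈ Ico (0:ℝ) 1, φ k x ∈ D) (H : ℝ → ℝ≥0∞) :
    ∫⁻ y in D, H y = ∑' k, ∫⁻ x in Ico (0:ℝ) 1, ENNReal.ofReal |φ' k x| * H (φ k x) := by
  have hU : D = ⋃ k, φ k '' Ico (0:ℝ) 1 := by
    ext y
    simp only [mem_iUnion, mem_image]
    constructor
    · intro hy; exact hD y hy
    · rintro ⟨k, x, hx, rfl⟩; exact hD' k x hx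
  have hinj : ∀ k, InjOn (φ k) (Ico (0:ℝ) 1) := by
    intro k x hx y hy h
    rw [← hT k x hx, h, hT k y hy]
  have hdis : Pairwise (Function.onFun Disjoint fun k => φ k '' Ico (0:ℝ) 1) := by
    intro k l hkl
    rw [Function.onFun, Set.disjoint_left]
    rintro _ ⟨x, hx, rfl⟩ ⟨y, hy, h⟩
    apply hkl
    rw [← hN k x hx, ← h, hN l y hy]
  rw [hU, lintegral_iUnion _ hdis]
  · refine tsum_congr fun k => ?_
    exact lintegral_image_eq_lintegral_abs_deriv_mul measurableSet_Ico
      (fun x hx => (hd k x hx).hasDerivWithinAt) (hinj k) H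
  · intro k
    exact measurableSet_Ico.image_of_continuousOn_injOn
      (fun x hx => (hd k x hx).continuousAt.continuousWithinAt) (hinj k)

lemma beta_branch (β : ℝ) (hβ : 1 < β) (H : ℝ → ℝ≥0∞) :
    ∫⁻ y in Ici (0:ℝ), H y = ∑' k : ℕ, ∫⁻ x in Ico (0:ℝ) 1, ENNReal.ofReal (1/β) * H ((x + k)/β) := by
  have hβ0 : 0 < β := by linarith
  have key : ∀ (k : ℕ) (x : ℝ), x ∈ Ico (0:ℝ) 1 → ⌊β * ((x + k)/β)⌋ = k := by
    intro k x hx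
    rw [mul_div_cancel₀ _ hβ0.ne', Int.floor_eq_iff]
    constructor <;> push_cast <;> linarith [hx.1, hx.2]
  have := branch (fun k x => (x + k)/β) (fun k x => 1/β) (betaT β) (fun x => ⌊β * x⌋.toNat) (Ici 0)
    ?_ ?_ ?_ ?_ ?_ H
  · rw [this]
    simp only [abs_of_pos (one_div_pos.2 hβ0)]
  · intro k x hx
    simp only [betaT]
    rw [key k x hx, mul_div_cancel₀ _ hβ0.ne']; push_cast; ring
  · intro k x hx
    simp only [key k x hx]; simp
  · intro k x hx
    exact ((hasDerivAt_id x).add_const _).div_const _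
  · intro y hy
    have h0 : 0 ≤ β * y := mul_nonneg hβ0.le hy
    refine ⟨⌊β * y⌋₊, β * y - ⌊β * y⌋₊, ⟨?_, ?_⟩, ?_⟩
    · linarith [Nat.floor_le h0]
    · linarith [Nat.lt_floor_add_one (β * y)]
    · field_simp; ring
  · intro k x hx
    exact div_nonneg (add_nonneg hx.1 (Nat.cast_nonneg k)) hβ0.le

lemma betaT_meas (β : ℝ) : Measurable (betaT β) := by
  unfold betaT
  fun_prop

noncomputable def bL (β : ℝ) (g : ℝ → ℝ≥0∞) : ℝ → ℝ≥0∞ :=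
  (Iio (1:ℝ)).indicator fun y => ∑' k : ℕ, ENNReal.ofReal (1/β) * g ((y + k)/β)

lemma bL_meas (β : ℝ) (g : ℝ → ℝ≥0∞) (hg : Measurable g) : Measurable (bL β g) := by
  unfold bL
  refine Measurable.indicator ?_ measurableSet_Iio
  refine Measurable.tsum fun k => ?_
  fun_prop

lemma beta_dual (β : ℝ) (hβ : 1 < β) (F g : ℝ → ℝ≥0∞) (hF : Measurable F) (hg : Measurable g) :
    ∫⁻ x in Ici (0:ℝ), F (betaT β x) * g x = ∫⁻ x in Ici (0:ℝ), F x * bL β g x := by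
  have hβ0 : 0 < β := by linarith
  rw [beta_branch β hβ]
  have e1 : ∀ k : ℕ, ∫⁻ x in Ico (0:ℝ) 1, ENNReal.ofReal (1/β) * (F (betaT β ((x + k)/β)) * g ((x + k)/β))
      = ∫⁻ x in Ico (0:ℝ) 1, F x * (ENNReal.ofReal (1/β) * g ((x + k)/β)) := by
    intro k
    refine setLIntegral_congr_fun measurableSet_Ico fun x hx => ?_
    have : betaT β ((x + k)/β) = x := by
      have : ⌊β * ((x + k)/β)⌋ = k := by
        rw [mul_div_cancel₀ _ hβ0.ne', Int.floor_eq_iff]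
        constructor <;> push_cast <;> linarith [hx.1, hx.2]
      simp only [betaT]
      rw [this, mul_div_cancel₀ _ hβ0.ne']; push_cast; ring
    simp only [this]
    ring
  simp_rw [e1]
  rw [← lintegral_tsum (fun k => by fun_prop)]
  simp_rw [ENNReal.tsum_mul_left]
  have : Ico (0:ℝ) 1 = Iio 1 ∩ Ici 0 := by ext; simp [and_comm]
  rw [this, ← Measure.restrict_restrict measurableSet_Iio, ← lintegral_indicator measurableSet_Iio]
  congr 1
  ext x
  unfold bL
  by_cases hx : x ∈ Iio (1:ℝ) <;> simp [hx, ENNReal.tsum_mul_left]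

lemma bL_anti (β : ℝ) (hβ : 1 < β) (g : ℝ → ℝ≥0∞) (hg : AntitoneOn g (Ici 0)) :
    AntitoneOn (bL β g) (Ici 0) := by
  have hβ0 : 0 < β := by linarith
  intro a ha b hb hab
  unfold bL
  by_cases hb1 : b ∈ Iio (1:ℝ)
  · have ha1 : a ∈ Iio (1:ℝ) := lt_of_le_of_lt hab hb1
    rw [indicator_of_mem hb1, indicator_of_mem ha1]
    refine ENNReal.tsum_le_tsum fun k => ?_
    gcongr
    apply hg
    · exact div_nonneg (add_nonneg ha (Nat.cast_nonneg k)) hβ0.le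
    · exact div_nonneg (add_nonneg hb (Nat.cast_nonneg k)) hβ0.le
    · gcongr
  · rw [indicator_of_notMem hb1]; exact bot_le

lemma bL_zero (β : ℝ) (hβ : 1 < β) (g : ℝ → ℝ≥0∞) (hg : AntitoneOn g (Ici 0)) :
    bL β g 0 ≤ g 0 + ∫⁻ x in Ici (0:ℝ), g x := by
  have hβ0 : 0 < β := by linarith
  have e0 : bL β g 0 = ∑' k : ℕ, ENNReal.ofReal (1/β) * g ((0 + (k:ℝ))/β) := by
    unfold bL
    exact indicator_of_mem (show (0:ℝ) ∈ Iio (1:ℝ) from mem_Iio.2 one_pos) _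
  have e1 : ∑' k : ℕ, ENNReal.ofReal (1/β) * g ((0 + (k:ℝ))/β) = 
      ENNReal.ofReal (1/β) * g ((0 + ((0:ℕ):ℝ))/β) + 
      ∑' k : ℕ, ENNReal.ofReal (1/β) * g ((0 + ((k+1:ℕ):ℝ))/β) :=
    tsum_eq_zero_add' (f := fun k : ℕ => ENNReal.ofReal (1/β) * g ((0 + (k:ℝ))/β)) ENNReal.summable
  have e2 : ENNReal.ofReal (1/β) * g ((0 + ((0:ℕ):ℝ))/β) ≤ g 0 := by
    simp only [Nat.cast_zero, add_zero, zero_div]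
    calc _ ≤ 1 * g 0 := by
          gcongr
          rw [ENNReal.ofReal_le_one, div_le_one hβ0]; exact hβ.le
      _ = _ := one_mul _
  have e3 : ∀ k : ℕ, ENNReal.ofReal (1/β) * g ((0 + ((k+1:ℕ):ℝ))/β) ≤ 
      ∫⁻ x in Ico (0:ℝ) 1, ENNReal.ofReal (1/β) * g ((x + k)/β) := by
    intro k
    have hc : ∫⁻ x in Ico (0:ℝ) 1, ENNReal.ofReal (1/β) * g ((0 + ((k+1:ℕ):ℝ))/β) 
        = ENNReal.ofReal (1/β) * g ((0 + ((k+1:ℕ):ℝ))/β) := by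
      rw [setLIntegral_const, Real.volume_Ico, sub_zero, ENNReal.ofReal_one, mul_one]
    rw [← hc]
    refine setLIntegral_mono_ae' measurableSet_Ico (Eventually.of_forall fun x hx => ?_)
    refine mul_le_mul_right ?_ _
    apply hg
    · exact div_nonneg (add_nonneg hx.1 (Nat.cast_nonneg k)) hβ0.le
    · exact div_nonneg (by positivity) hβ0.le
    · refine div_le_div_of_nonneg_right ?_ hβ0.le
      push_cast
      linarith [hx.2]
  rw [e0, e1, beta_branch β hβ]
  exact add_le_add e2 (ENNReal.tsum_le_tsum e3)

lemma beta_iter_bound (β : ℝ) (hβ : 1 < β) (F : ℝ → ℝ≥0∞) (hF : Measurable F) (n : ℕ) :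
    ∀ g : ℝ → ℝ≥0∞, Measurable g → AntitoneOn g (Ici 0) → (∀ x, 1 ≤ x → g x = 0) →
    ∫⁻ x in Ici (0:ℝ), F ((betaT β)^[n] x) * g x ≤ 
      (g 0 + n * ∫⁻ x in Ici (0:ℝ), g x) * ∫⁻ x in Ico (0:ℝ) 1, F x := by
  induction n with
  | zero =>
    intro g hg ha h0
    simp only [Function.iterate_zero, id, Nat.cast_zero, zero_mul, add_zero]
    have : Ico (0:ℝ) 1 = Iio 1 ∩ Ici 0 := by ext; simp [and_comm]
    rw [this, ← Measure.restrict_restrict measurableSet_Iio, ← lintegral_indicator measurableSet_Iio,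
      ← lintegral_const_mul _ (hF.indicator measurableSet_Iio)]
    refine setLIntegral_mono_ae' measurableSet_Ici (Eventually.of_forall fun x hx => ?_)
    by_cases h1 : x < 1
    · rw [indicator_of_mem (show x ∈ Iio (1:ℝ) from h1), mul_comm]
      gcongr
      exact ha (by simp) hx hx
    · rw [h0 x (not_lt.1 h1)]; simp
  | succ n ih =>
    intro g hg ha h0
    have e := beta_dual β hβ (fun x => F ((betaT β)^[n] x)) g (hF.comp ((betaT_meas β).iterate n)) hg
    simp only [Function.iterate_succ_apply]
    rw [e]
    refine (ih (bL β g) (bL_meas β g hg) (bL_anti β hβ g ha) ?_).trans ?_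
    · intro x hx
      unfold bL
      rw [indicator_of_notMem (by simpa using hx)]
    · refine mul_le_mul_left ?_ _
      have e2 := beta_dual β hβ (fun _ => 1) g measurable_const hg
      simp only [one_mul] at e2
      rw [← e2]
      calc _ ≤ g 0 + (∫⁻ x in Ici (0:ℝ), g x) + n * ∫⁻ x in Ici (0:ℝ), g x := by
            gcongr; exact bL_zero β hβ g ha
        _ = _ := by push_cast; ring

lemma beta_vol (β : ℝ) (hβ : 1 < β) (n : ℕ) (ε : ℝ) :
    volume.restrict (Ico (0:ℝ) 1) {x | (betaT β)^[n] x < ε} ≤ (1 + n) * ENNReal.ofReal ε := by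
  have hm : MeasurableSet {x | (betaT β)^[n] x < ε} :=
    measurableSet_lt ((betaT_meas β).iterate n) measurable_const
  have h := beta_iter_bound β hβ ((Iio ε).indicator 1) (measurable_one.indicator measurableSet_Iio) n
    ((Iio (1:ℝ)).indicator 1) (measurable_one.indicator measurableSet_Iio) ?_ ?_
  · have hI : Ico (0:ℝ) 1 = Iio 1 ∩ Ici 0 := by ext; simp [and_comm]
    have e1 : ∫⁻ x in Ici (0:ℝ), (Iio (1:ℝ)).indicator (1 : ℝ → ℝ≥0∞) x = 1 := by
      rw [lintegral_indicator_one measurableSet_Iio, Measure.restrict_apply measurableSet_Iio, ← hI]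
      simp
    have e2 : ∫⁻ x in Ico (0:ℝ) 1, (Iio ε).indicator (1 : ℝ → ℝ≥0∞) x ≤ ENNReal.ofReal ε := by
      rw [lintegral_indicator_one measurableSet_Iio, Measure.restrict_apply measurableSet_Iio]
      calc _ ≤ volume (Ico 0 ε) := measure_mono (by rintro x ⟨h1, h2⟩; exact ⟨h2.1, h1⟩)
        _ = _ := by simp
    have e3 : volume.restrict (Ico (0:ℝ) 1) {x | (betaT β)^[n] x < ε} = 
        ∫⁻ x in Ici (0:ℝ), (Iio ε).indicator (1 : ℝ → ℝ≥0∞) ((betaT β)^[n] x) * (Iio (1:ℝ)).indicator 1 x := by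
      rw [hI, ← Measure.restrict_restrict measurableSet_Iio, ← lintegral_indicator_one hm,
        ← lintegral_indicator measurableSet_Iio]
      congr 1
      ext x
      simp only [indicator, mem_Iio, mem_ofPred_eq, Pi.one_apply]
      split_ifs <;> simp
    rw [e3]
    refine h.trans ?_
    rw [e1]
    gcongr
    · simp
    · simp
  · intro a ha b hb hab
    by_cases h1 : b < 1
    · have : a < 1 := by linarith
      simp [indicator, h1, this]
    · simp [indicator, h1]
  · intro x hx
    simp [indicator, hx]

lemma beta_ae (β : ℝ) (hβ : 1 < β) : ∀ᵐ x ∂(volume.restrict (Set.Ico (0:ℝ) 1)),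
    ∀ᶠ n : ℕ in atTop, 1 / ((n:ℝ)+1)^3 ≤ (betaT β)^[n] x := by
  have := ae_eventually_notMem (μ := volume.restrict (Set.Ico (0:ℝ) 1))
    (s := fun n : ℕ => {x | (betaT β)^[n] x < 1 / ((n:ℝ)+1)^3}) ?_
  · filter_upwards [this] with x hx
    filter_upwards [hx] with n hn
    simpa using hn
  · have hs : Summable (fun n : ℕ => 1 / ((n:ℝ)+1)^2) := by
      have := (summable_nat_add_iff 1).2 (Real.summable_one_div_nat_pow.2 (show 1 < 2 by norm_num))
      simpa using this
    refine ne_top_of_le_ne_top hs.tsum_ofReal_ne_top (ENNReal.tsum_le_tsum fun n => ?_)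
    refine (beta_vol β hβ n _).trans (le_of_eq ?_)
    have : (1 + (n:ℝ≥0∞)) = ENNReal.ofReal (1 + n) := by
      rw [ENNReal.ofReal_add zero_le_one (Nat.cast_nonneg n)]; simp
    rw [this, ← ENNReal.ofReal_mul (by positivity)]
    congr 1
    field_simp
    ring

end KN

namespace KN

open scoped ENNReal

noncomputable def wt (x : ℝ) : ℝ≥0∞ := ENNReal.ofReal (1 / (Real.log 2 * (1 + x)))

noncomputable def gμ : Measure ℝ := (volume.restrict (Ico (0:ℝ) 1)).withDensity wt

noncomputable def pk (k : ℕ) (x : ℝ) : ℝ := (1 + x) / ((x + (k+1)) * (x + (k+2)))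

noncomputable def gU (g : ℝ → ℝ≥0∞) (x : ℝ) : ℝ≥0∞ := 
  ∑' k : ℕ, ENNReal.ofReal (pk k x) * g (1 / (x + (k+1)))

lemma wt_meas : Measurable wt := by unfold wt; fun_prop

lemma lint_gμ (F : ℝ → ℝ≥0∞) (hF : Measurable F) : 
    ∫⁻ x, F x ∂gμ = ∫⁻ x in Ico (0:ℝ) 1, wt x * F x := by
  unfold gμ
  rw [lintegral_withDensity_eq_lintegral_mul _ wt_meas hF]; rfl

lemma gU_meas (g : ℝ → ℝ≥0∞) (hg : Measurable g) : Measurable (gU g) := by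
  unfold gU pk
  refine Measurable.tsum fun k => ?_
  fun_prop

lemma gauss_meas : Measurable gaussMap := by
  unfold gaussMap
  refine Measurable.ite (measurableSet_singleton 0) measurable_const ?_
  fun_prop

lemma floor_branch (k : ℕ) (x : ℝ) (hx : x ∈ Ico (0:ℝ) 1) : ⌊1 / (1 / (x + ((k:ℝ)+1)))⌋ = (k + 1 : ℕ) := by
  rw [one_div_one_div, Int.floor_eq_iff]
  push_cast
  constructor <;> linarith [hx.1, hx.2]

lemma gauss_inv (k : ℕ) (x : ℝ) (hx : x ∈ Ico (0:ℝ) 1) : gaussMap (1 / (x + ((k:ℝ)+1))) = x := by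
  have : 0 < x + ((k:ℝ)+1) := by have := hx.1; positivity
  unfold gaussMap
  rw [if_neg (by positivity), floor_branch k x hx, one_div_one_div]
  push_cast; ring

lemma gauss_branch (H : ℝ → ℝ≥0∞) :
    ∫⁻ y in Ico (0:ℝ) 1, H y = ∑' k : ℕ, ∫⁻ x in Ico (0:ℝ) 1, 
      ENNReal.ofReal (1/(x + ((k:ℝ)+1))^2) * H (1 / (x + ((k:ℝ)+1))) := by
  have e0 : ∫⁻ y in Ico (0:ℝ) 1, H y = ∫⁻ y in Ioc (0:ℝ) 1, H y := by
    rw [Measure.restrict_congr_set (Ico_ae_eq_Ioc (a := (0:ℝ)) (b := 1))]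
  rw [e0]
  have := branch (fun k x => 1 / (x + ((k:ℝ)+1))) (fun k x => -1/(x + ((k:ℝ)+1))^2) gaussMap
    (fun x => ⌊1/x⌋.toNat - 1) (Ioc 0 1) ?_ ?_ ?_ ?_ ?_ H
  · rw [this]
    refine tsum_congr fun k => setLIntegral_congr_fun measurableSet_Ico fun x hx => ?_
    have : 0 < x + ((k:ℝ)+1) := by have := hx.1; positivity
    have e : |(-1:ℝ)/(x + ((k:ℝ)+1))^2| = 1/(x + ((k:ℝ)+1))^2 := by
      rw [abs_div, abs_neg, abs_one, abs_of_pos (by positivity)]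
    simp only [e]
  · exact gauss_inv
  · intro k x hx
    simp only [floor_branch k x hx]; simp
  · intro k x hx
    have : 0 < x + ((k:ℝ)+1) := by have := hx.1; positivity
    have h := ((hasDerivAt_id' x).add_const ((k:ℝ)+1)).fun_inv this.ne'
    simpa [one_div] using h
  · intro y hy
    have h1 : 1 ≤ 1 / y := by rw [le_div_iff₀ hy.1]; linarith [hy.2]
    have h0 : 0 ≤ 1 / y := by linarith
    have hf : 1 ≤ ⌊1/y⌋₊ := by rw [Nat.one_le_floor_iff]; exact h1
    refine ⟨⌊1/y⌋₊ - 1, 1/y - ⌊1/y⌋₊, ⟨?_, ?_⟩, ?_⟩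
    · linarith [Nat.floor_le h0]
    · linarith [Nat.lt_floor_add_one (1/y)]
    · push_cast [hf]
      simp
  · intro k x hx
    have h0 : (0:ℝ) ≤ k := Nat.cast_nonneg k
    have : 0 < x + ((k:ℝ)+1) := by have := hx.1; positivity
    refine ⟨by positivity, ?_⟩
    rw [div_le_one this]; linarith [hx.1]

lemma gauss_dual (F G : ℝ → ℝ≥0∞) (hF : Measurable F) (hG : Measurable G) :
    ∫⁻ x, F (gaussMap x) * G x ∂gμ = ∫⁻ x, F x * gU G x ∂gμ := by
  rw [lint_gμ (fun x => F (gaussMap x) * G x) ((hF.comp gauss_meas).mul hG),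
    lint_gμ (fun x => F x * gU G x) (hF.mul (gU_meas G hG)), gauss_branch]
  have hl : 0 < Real.log 2 := Real.log_pos (by norm_num)
  have e1 : ∀ k : ℕ, ∫⁻ x in Ico (0:ℝ) 1, 
      ENNReal.ofReal (1/(x + ((k:ℝ)+1))^2) * (wt (1 / (x + ((k:ℝ)+1))) * (F (gaussMap (1 / (x + ((k:ℝ)+1)))) * G (1 / (x + ((k:ℝ)+1)))))
      = ∫⁻ x in Ico (0:ℝ) 1, (wt x * F x) * (ENNReal.ofReal (pk k x) * G (1 / (x + (k+1)))) := by
    intro k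
    refine setLIntegral_congr_fun measurableSet_Ico fun x hx => ?_
    have h0 : 0 < x + ((k:ℝ)+1) := by have := hx.1; positivity
    have hx1 : 0 < 1 + x := by linarith [hx.1]
    have e : ENNReal.ofReal (1/(x + ((k:ℝ)+1))^2) * wt (1 / (x + ((k:ℝ)+1))) = wt x * ENNReal.ofReal (pk k x) := by
      unfold wt pk
      rw [← ENNReal.ofReal_mul (by positivity), ← ENNReal.ofReal_mul (by positivity)]
      congr 1
      have h2 : 0 < x + ((k:ℝ)+2) := by linarith
      field_simp
      ring
    simp only [gauss_inv k x hx]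
    rw [← mul_assoc, e]; ring
  simp_rw [e1]
  rw [← lintegral_tsum]
  · congr 1
    ext x
    rw [ENNReal.tsum_mul_left, mul_assoc]; rfl
  · intro k
    have := wt_meas
    unfold pk
    fun_prop

lemma gauss_dual_iter (F : ℝ → ℝ≥0∞) (hF : Measurable F) (n : ℕ) : ∀ (G : ℝ → ℝ≥0∞) (hG : Measurable G),
    ∫⁻ x, F (gaussMap^[n] x) * G x ∂gμ = ∫⁻ x, F x * (gU^[n] G) x ∂gμ := by
  induction n with
  | zero => intro G hG; rfl
  | succ n ih =>
    intro G hG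
    simp only [Function.iterate_succ_apply]
    rw [← ih (gU G) (gU_meas G hG), ← gauss_dual (fun x => F (gaussMap^[n] x)) G (hF.comp (gauss_meas.iterate n)) hG]

lemma pk_nonneg (k : ℕ) (x : ℝ) (hx : 0 ≤ x) : 0 ≤ pk k x := by
  unfold pk; positivity

lemma pk_hasSum (x : ℝ) (hx : 0 ≤ x) (j : ℕ) : 
    HasSum (fun k => pk (k + j) x) ((1 + x)/(x + (j+1))) := by
  rw [hasSum_iff_tendsto_nat_of_nonneg (fun k => pk_nonneg _ _ hx)]
  have e : ∀ n : ℕ, ∑ k ∈ Finset.range n, pk (k + j) x = (1+x)/(x + (j+1)) - (1 + x)/(x + (j+1) + n) := by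
    intro n
    induction n with
    | zero => simp
    | succ n ih =>
      rw [Finset.sum_range_succ, ih]
      unfold pk
      push_cast
      field_simp
      ring
  simp_rw [e]
  have : Tendsto (fun n : ℕ => (1 + x)/(x + (j+1) + n)) atTop (nhds 0) :=
    tendsto_const_nhds.div_atTop (tendsto_atTop_add_const_left _ _ tendsto_natCast_atTop_atTop)
  simpa using tendsto_const_nhds.sub this

lemma pk_tsum (x : ℝ) (hx : 0 ≤ x) (j : ℕ) : 
    ∑' k, ENNReal.ofReal (pk (k + j) x) = ENNReal.ofReal ((1 + x)/(x + (j+1))) := by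
  rw [← (pk_hasSum x hx j).tsum_eq, ENNReal.ofReal_tsum_of_nonneg (fun k => pk_nonneg _ _ hx) (pk_hasSum x hx j).summable]

lemma pk_tsum_zero (x : ℝ) (hx : 0 ≤ x) : ∑' k, ENNReal.ofReal (pk k x) = 1 := by
  have := pk_tsum x hx 0
  simp only [add_zero, Nat.cast_zero, zero_add] at this
  rw [this, add_comm x 1, div_self (by positivity), ENNReal.ofReal_one]

lemma gU_const (M : ℝ≥0∞) (x : ℝ) (hx : 0 ≤ x) : gU (fun _ => M) x = M := by
  unfold gU
  rw [ENNReal.tsum_mul_right, pk_tsum_zero x hx, one_mul]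

lemma abel (h : ℕ → ℝ≥0∞) (hm : Monotone h) (x : ℝ) (hx : 0 ≤ x) :
    ∑' k, ENNReal.ofReal (pk k x) * h k = 
      ∑' j : ℕ, (h j - (if j = 0 then 0 else h (j-1))) * ENNReal.ofReal ((1 + x)/(x + (j+1))) := by
  set d : ℕ → ℝ≥0∞ := fun j => (h j - (if j = 0 then 0 else h (j-1))) with hd
  have e1 : ∀ k, h k = ∑' j, if j ≤ k then d j else 0 := by
    intro k
    have : ∑' j, (if j ≤ k then d j else 0) = ∑ j ∈ Finset.range (k+1), d j := by
      rw [tsum_eq_sum (s := Finset.range (k+1))]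
      · refine Finset.sum_congr rfl fun j hj => ?_
        rw [if_pos (by simp at hj; omega)]
      · intro j hj
        rw [if_neg (by simp at hj; omega)]
    rw [this]
    clear this
    induction k with
    | zero => simp [hd]
    | succ k ih =>
      rw [Finset.sum_range_succ, ← ih, hd]
      simp only [Nat.succ_ne_zero, if_false, Nat.add_sub_cancel]
      rw [add_tsub_cancel_of_le (hm (Nat.le_succ k))]
  have e2 : ∀ k, ENNReal.ofReal (pk k x) * h k = ∑' j, d j * (if j ≤ k then ENNReal.ofReal (pk k x) else 0) := by
    intro k
    rw [e1 k, ← ENNReal.tsum_mul_left]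
    refine tsum_congr fun j => ?_
    split_ifs <;> simp [mul_comm]
  simp_rw [e2]
  rw [ENNReal.tsum_comm]
  refine tsum_congr fun j => ?_
  rw [ENNReal.tsum_mul_left]
  congr 1
  rw [← pk_tsum x hx j]
  have := (ENNReal.summable (f := fun k => if j ≤ k + j then ENNReal.ofReal (pk (k+j) x) else 0)).hasSum
  have h2 := ENNReal.sum_add_tsum_compl (Finset.range j) (fun k => if j ≤ k then ENNReal.ofReal (pk k x) else 0)
  rw [← Summable.sum_add_tsum_nat_add' (k := j) ENNReal.summable]
  rw [Finset.sum_eq_zero]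
  · simp
  · intro k hk
    rw [if_neg (by simp at hk; omega)]

/-- U maps antitone functions to monotone ones. -/
lemma gU_mono (g : ℝ → ℝ≥0∞) (hg : AntitoneOn g (Ioc 0 1)) : MonotoneOn (gU g) (Icc 0 1) := by
  intro x hx y hy hxy
  have hmem : ∀ (z : ℝ), z ∈ Icc (0:ℝ) 1 → ∀ k : ℕ, 1 / (z + ((k:ℝ)+1)) ∈ Ioc (0:ℝ) 1 := by
    intro z hz k
    have h0 : (0:ℝ) ≤ k := Nat.cast_nonneg k
    have : 0 < z + ((k:ℝ)+1) := by have := hz.1; positivity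
    refine ⟨by positivity, ?_⟩
    rw [div_le_one this]; linarith [hz.1]
  have hx0 := hx.1
  have hy0 := hy.1
  have hmono : Monotone (fun k : ℕ => g (1 / (y + ((k:ℝ)+1)))) := by
    intro k l hkl
    refine hg (hmem y hy l) (hmem y hy k) ?_
    have : (k:ℝ) ≤ l := by exact_mod_cast hkl
    apply one_div_le_one_div_of_le <;> [positivity; linarith]
  calc gU g x ≤ ∑' k : ℕ, ENNReal.ofReal (pk k x) * g (1 / (y + ((k:ℝ)+1))) := by
        refine ENNReal.tsum_le_tsum fun k => mul_le_mul_right (hg (hmem y hy k) (hmem x hx k) ?_) _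
        apply one_div_le_one_div_of_le <;> [positivity; linarith]
    _ ≤ ∑' k : ℕ, ENNReal.ofReal (pk k y) * g (1 / (y + ((k:ℝ)+1))) := by
        rw [abel _ hmono x hx0, abel _ hmono y hy0]
        refine ENNReal.tsum_le_tsum fun j => mul_le_mul_right (ENNReal.ofReal_le_ofReal ?_) _
        have : (0:ℝ) ≤ j := Nat.cast_nonneg j
        rw [div_le_div_iff₀ (by positivity) (by positivity)]
        nlinarith [mul_nonneg this (sub_nonneg.2 hxy)]

lemma gU_bound (g : ℝ → ℝ≥0∞) (a b : ℝ≥0∞) (h : ∀ x ∈ Ioc (0:ℝ) 1, a ≤ g x ∧ g x ≤ b) (x : ℝ) (hx : 0 ≤ x) :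
    a ≤ gU g x ∧ gU g x ≤ b := by
  have hmem : ∀ k : ℕ, 1 / (x + ((k:ℝ)+1)) ∈ Ioc (0:ℝ) 1 := by
    intro k
    have h0 : (0:ℝ) ≤ k := Nat.cast_nonneg k
    refine ⟨by positivity, ?_⟩
    rw [div_le_one (by positivity)]; linarith
  constructor
  · rw [← gU_const a x hx]
    exact ENNReal.tsum_le_tsum fun k => mul_le_mul_right (h _ (hmem k)).1 _
  · rw [← gU_const b x hx]
    exact ENNReal.tsum_le_tsum fun k => mul_le_mul_right (h _ (hmem k)).2 _

lemma gU_anti (g : ℝ → ℝ≥0∞) (hg : MonotoneOn g (Ioc 0 1)) (hfin : g 1 ≠ ∞) : AntitoneOn (gU g) (Icc 0 1) := by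
  intro x hx y hy hxy
  have h1 : ∀ z ∈ Ioc (0:ℝ) 1, g z ≤ g 1 := fun z hz => hg hz (by simp) hz.2
  have hm : MonotoneOn (gU (fun z => g 1 - g z)) (Icc 0 1) := by
    apply gU_mono
    intro a ha b hb hab
    exact tsub_le_tsub_left (hg ha hb hab) _
  have hs : ∀ z ∈ Icc (0:ℝ) 1, gU g z + gU (fun z => g 1 - g z) z = g 1 := by
    intro z hz
    have hz0 := hz.1
    refine Eq.trans ?_ (gU_const (g 1) z hz.1)
    unfold gU
    rw [← ENNReal.tsum_add]
    refine tsum_congr fun k => ?_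
    rw [← mul_add, add_tsub_cancel_of_le]
    apply h1
    have h0 : (0:ℝ) ≤ k := Nat.cast_nonneg k
    refine ⟨by positivity, ?_⟩
    rw [div_le_one (by positivity)]; linarith
  have e1 := hs x hx
  have e2 := hs y hy
  have hf : gU (fun z => g 1 - g z) y ≠ ∞ := by
    intro h
    rw [h] at e2
    simp at e2
    exact hfin e2.symm
  have : gU g y + gU (fun z => g 1 - g z) y ≤ gU g x + gU (fun z => g 1 - g z) y := by
    rw [e2]
    exact e1.symm.le.trans (add_le_add le_rfl (hm hx hy hxy))
  exact (ENNReal.add_le_add_iff_right hf).1 this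

lemma gU_ident (g : ℝ → ℝ≥0∞) : 2 * gU g 0 = g 1 + gU g 1 := by
  have e1 : gU g 0 = ENNReal.ofReal (1/2) * g 1 + 
      ∑' k : ℕ, ENNReal.ofReal (pk (k+1) 0) * g (1 / (0 + (((k+1:ℕ):ℝ)+1))) := by
    unfold gU
    rw [tsum_eq_zero_add' ENNReal.summable]
    congr 1
    unfold pk
    norm_num
  rw [e1, mul_add, ← ENNReal.tsum_mul_left]
  congr 1
  · rw [← mul_assoc, show (2:ℝ≥0∞) = ENNReal.ofReal 2 by simp, ← ENNReal.ofReal_mul (by norm_num)]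
    norm_num
  · unfold gU
    refine tsum_congr fun k => ?_
    rw [← mul_assoc, show (2:ℝ≥0∞) = ENNReal.ofReal 2 by simp, ← ENNReal.ofReal_mul (by norm_num)]
    congr 2
    · unfold pk
      push_cast
      field_simp
      ring
    · push_cast; ring

def Osc (g : ℝ → ℝ≥0∞) (δ : ℝ≥0∞) : Prop :=
  (g 0 ≠ ∞ ∧ g 1 ≠ ∞) ∧ 
  ((AntitoneOn g (Icc 0 1) ∧ g 0 ≤ g 1 + δ) ∨ (MonotoneOn g (Icc 0 1) ∧ g 1 ≤ g 0 + δ))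

lemma half_aux (a b δ : ℝ≥0∞) (h : 2 * a ≤ 2 * b + δ) : a ≤ b + δ / 2 := by
  have : 2 * a ≤ 2 * (b + δ / 2) := by
    rw [mul_add, ENNReal.mul_div_cancel (by simp) (by simp)]; exact h
  exact (ENNReal.mul_le_mul_iff_right (by simp) (by simp)).1 this

lemma Osc_step (g : ℝ → ℝ≥0∞) (δ : ℝ≥0∞) (h : Osc g δ) : Osc (gU g) (δ / 2) := by
  obtain ⟨⟨f0, f1⟩, h⟩ := h
  have id := gU_ident g
  have m0 : (0:ℝ) ∈ Icc (0:ℝ) 1 := by simp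
  have m1 : (1:ℝ) ∈ Icc (0:ℝ) 1 := by simp
  have sub : Ioc (0:ℝ) 1 ⊆ Icc 0 1 := Ioc_subset_Icc_self
  rcases h with ⟨ha, hδ⟩ | ⟨hm, hδ⟩
  · have hb : ∀ x ∈ Ioc (0:ℝ) 1, g 1 ≤ g x ∧ g x ≤ g 0 := fun x hx =>
      ⟨ha (sub hx) m1 hx.2, ha m0 (sub hx) hx.1.le⟩
    have b0 := gU_bound g _ _ hb 0 le_rfl
    have b1 := gU_bound g _ _ hb 1 zero_le_one
    refine ⟨⟨ne_top_of_le_ne_top f0 b0.2, ne_top_of_le_ne_top f0 b1.2⟩, Or.inr ⟨gU_mono g (ha.mono sub), ?_⟩⟩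
    apply half_aux
    rw [id, two_mul]
    calc gU g 1 + gU g 1 ≤ (g 1 + δ) + gU g 1 := by gcongr; exact b1.2.trans hδ
      _ = _ := by ring
  · have hb : ∀ x ∈ Ioc (0:ℝ) 1, g 0 ≤ g x ∧ g x ≤ g 1 := fun x hx =>
      ⟨hm m0 (sub hx) hx.1.le, hm (sub hx) m1 hx.2⟩
    have b0 := gU_bound g _ _ hb 0 le_rfl
    have b1 := gU_bound g _ _ hb 1 zero_le_one
    refine ⟨⟨ne_top_of_le_ne_top f1 b0.2, ne_top_of_le_ne_top f1 b1.2⟩, Or.inl ⟨gU_anti g (hm.mono sub) f1, ?_⟩⟩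
    apply half_aux
    rw [id, two_mul]
    calc g 1 + gU g 1 ≤ (gU g 1 + δ) + gU g 1 := by 
          gcongr
          refine hδ.trans ?_
          gcongr
          exact b1.1
      _ = _ := by ring

lemma Osc_le (g : ℝ → ℝ≥0∞) (δ : ℝ≥0∞) (h : Osc g δ) (x y : ℝ) (hx : x ∈ Icc (0:ℝ) 1) (hy : y ∈ Icc (0:ℝ) 1) :
    g x ≤ g y + δ := by
  have m0 : (0:ℝ) ∈ Icc (0:ℝ) 1 := by simp
  have m1 : (1:ℝ) ∈ Icc (0:ℝ) 1 := by simp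
  rcases h.2 with ⟨ha, hδ⟩ | ⟨hm, hδ⟩
  · calc g x ≤ g 0 := ha m0 hx hx.1
      _ ≤ g 1 + δ := hδ
      _ ≤ g y + δ := by gcongr; exact ha hy m1 hy.2
  · calc g x ≤ g 1 := hm hx m1 hx.2
      _ ≤ g 0 + δ := hδ
      _ ≤ g y + δ := by gcongr; exact hm m0 hy hy.1

end KN

namespace KN

open scoped ENNReal

lemma lint_ftc (F F' : ℝ → ℝ) (hc : ContinuousOn F (Icc 0 1)) 
    (hd : ∀ x ∈ Ioo (0:ℝ) 1, HasDerivAt F (F' x) x) (hn : ∀ x ∈ Ioo (0:ℝ) 1, 0 ≤ F' x) :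
    ∫⁻ x in Ico (0:ℝ) 1, ENNReal.ofReal (F' x) = ENNReal.ofReal (F 1 - F 0) := by
  have hi : IntegrableOn F' (Ioc 0 1) := 
    intervalIntegral.integrableOn_deriv_of_nonneg hc hd hn
  have h1 := intervalIntegral.integral_eq_sub_of_hasDerivAt_of_le zero_le_one hc hd 
    ((intervalIntegrable_iff_integrableOn_Ioc_of_le zero_le_one).2 hi)
  rw [← h1, intervalIntegral.integral_of_le zero_le_one]
  have e : volume.restrict (Ico (0:ℝ) 1) = volume.restrict (Ioo (0:ℝ) 1) := 
    (Measure.restrict_congr_set Ioo_ae_eq_Ico).symm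
  have e' : volume.restrict (Ioc (0:ℝ) 1) = volume.restrict (Ioo (0:ℝ) 1) := 
    (Measure.restrict_congr_set Ioo_ae_eq_Ioc).symm
  rw [IntegrableOn, e'] at hi
  rw [e, e']
  rw [ofReal_integral_eq_lintegral_ofReal hi]
  exact (ae_restrict_iff' measurableSet_Ioo).2 (Eventually.of_forall hn)

lemma log2_pos : 0 < Real.log 2 := Real.log_pos (by norm_num)

lemma lint_one : ∫⁻ _, 1 ∂gμ = 1 := by
  rw [lint_gμ _ measurable_const]
  simp only [mul_one]
  unfold wt
  have hl := log2_pos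
  rw [lint_ftc (fun x => Real.log (1 + x) / Real.log 2)]
  · norm_num [hl.ne']
  · refine ContinuousOn.div_const (ContinuousOn.log (by fun_prop) ?_) _
    intro x hx
    have := hx.1
    positivity
  · intro x hx
    have : (0:ℝ) < 1 + x := by linarith [hx.1]
    have h := (((hasDerivAt_id' x).const_add 1).log this.ne').div_const (Real.log 2)
    refine h.congr_deriv ?_
    field_simp
  · intro x hx
    have : (0:ℝ) < 1 + x := by linarith [hx.1]
    positivity

noncomputable def ff (x : ℝ) : ℝ≥0∞ := ENNReal.ofReal (- Real.log x)

lemma ff_meas : Measurable ff := by unfold ff; fun_prop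

lemma ff_anti : AntitoneOn ff (Ioc 0 1) := by
  intro x hx y hy hxy
  unfold ff
  apply ENNReal.ofReal_le_ofReal
  have := Real.log_le_log hx.1 hxy
  linarith

lemma ff_one : ff 1 = 0 := by simp [ff]

lemma ff_top (x : ℝ) : ff x ≠ ∞ := ENNReal.ofReal_ne_top

noncomputable def cR : ℝ := Real.pi^2 / (12 * Real.log 2)

lemma cR_pos : 0 < cR := by
  unfold cR
  have := log2_pos
  have := Real.pi_pos
  positivity

lemma sum_alt : HasSum (fun n : ℕ => 1/(2*(n:ℝ)+1)^2 - 1/(2*(n:ℝ)+2)^2) (Real.pi^2/12) := by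
  have hz := hasSum_zeta_two
  have he : HasSum (fun n : ℕ => 1/((2*n:ℕ):ℝ)^2) (Real.pi^2/24) := by
    have := hz.mul_left (1/4)
    rw [show Real.pi^2/24 = 1/4 * (Real.pi^2/6) by ring, show (fun n : ℕ => 1/((2*n:ℕ):ℝ)^2) = 
      fun n : ℕ => 1/4 * (1/(n:ℝ)^2) from funext fun n => by push_cast; ring]
    exact this
  have ho : Summable (fun n : ℕ => 1/((2*n+1:ℕ):ℝ)^2) := 
    hz.summable.comp_injective (i := fun n : ℕ => 2*n+1) (fun a b h => by simpa using h)
  have hs := he.even_add_odd (f := fun n : ℕ => 1/(n:ℝ)^2) ho.hasSum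
  have e1 := hs.unique hz
  have ho' : HasSum (fun n : ℕ => 1/((2*n+1:ℕ):ℝ)^2) (Real.pi^2/8) := by
    have := ho.hasSum
    convert this using 1
    linarith
  have he' := (hasSum_nat_add_iff' 1).2 he
  have := ho'.sub he'
  rw [show Real.pi^2/12 = Real.pi ^ 2 / 8 - (Real.pi ^ 2 / 24 - ∑ i ∈ Finset.range 1, 1 / ((2 * i : ℕ):ℝ) ^ 2) by simp; ring,
    show (fun n : ℕ => 1/(2*(n:ℝ)+1)^2 - 1/(2*(n:ℝ)+2)^2) = fun n : ℕ => 1/((2*n+1:ℕ):ℝ)^2 - 1/((2*(n+1):ℕ):ℝ)^2 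
      from funext fun n => by push_cast; ring]
  exact this

lemma lint_term (n : ℕ) : ∫⁻ x in Ico (0:ℝ) 1, ENNReal.ofReal (-Real.log x * ((1-x) * x^(2*n))) = 
    ENNReal.ofReal (1/(2*(n:ℝ)+1)^2 - 1/(2*(n:ℝ)+2)^2) := by
  rw [lint_ftc (fun x => (-(x^(2*n) * (x * Real.log x))/(2*n+1) + x^(2*n+1)/(2*n+1)^2) - 
     (-(x^(2*n+1) * (x * Real.log x))/(2*n+2) + x^(2*n+2)/(2*n+2)^2))]
  · congr 1
    simp
  · have := Real.continuous_mul_log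
    apply Continuous.continuousOn
    fun_prop
  · intro x hx
    have hx0 := hx.1
    have hl := Real.hasDerivAt_mul_log hx0.ne'
    have h1 : HasDerivAt (fun x : ℝ => (-(x^(2*n) * (x * Real.log x))/(2*n+1) + x^(2*n+1)/(2*n+1)^2)) (-Real.log x * x^(2*n)) x := by
      have A : HasDerivAt (fun x : ℝ => (-(x^(2*n+1) * Real.log x)/(2*n+1) + x^(2*n+1)/(2*n+1)^2)) (-Real.log x * x^(2*n)) x := by
        have a := hasDerivAt_pow (2*n+1) x
        have b := (((a.mul (Real.hasDerivAt_log hx0.ne')).neg.div_const (2*n+1)).add (a.div_const ((2*n+1)^2)))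
        refine b.congr_deriv ?_
        push_cast
        field_simp
        ring
      refine A.congr_of_eventuallyEq (Eventually.of_forall fun x => ?_)
      ring
    have h2 : HasDerivAt (fun x : ℝ => (-(x^(2*n+1) * (x * Real.log x))/(2*n+2) + x^(2*n+2)/(2*n+2)^2)) (-Real.log x * x^(2*n+1)) x := by
      have A : HasDerivAt (fun x : ℝ => (-(x^(2*n+2) * Real.log x)/(2*n+2) + x^(2*n+2)/(2*n+2)^2)) (-Real.log x * x^(2*n+1)) x := by
        have a := hasDerivAt_pow (2*n+2) x
        have b := (((a.mul (Real.hasDerivAt_log hx0.ne')).neg.div_const (2*n+2)).add (a.div_const ((2*n+2)^2)))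
        refine b.congr_deriv ?_
        push_cast
        field_simp
        ring
      refine A.congr_of_eventuallyEq (Eventually.of_forall fun x => ?_)
      ring
    refine (h1.sub h2).congr_deriv ?_
    ring
  · intro x hx
    have := Real.log_nonpos hx.1.le hx.2.le
    have h1 : 0 ≤ 1 - x := by linarith [hx.2]
    have hx0 := hx.1
    have : 0 ≤ - Real.log x := by linarith
    positivity

lemma lint_ff : ∫⁻ x, ff x ∂gμ = ENNReal.ofReal cR := by
  rw [lint_gμ _ ff_meas]
  have hl := log2_pos
  have e : ∀ x ∈ Ico (0:ℝ) 1, wt x * ff x = ENNReal.ofReal (1/Real.log 2) * 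
      ∑' n : ℕ, ENNReal.ofReal (-Real.log x * ((1-x) * x^(2*n))) := by
    intro x hx
    have hx0 := hx.1
    have h1 : 0 ≤ 1 - x := by linarith [hx.2]
    have hl0 : 0 ≤ - Real.log x := by linarith [Real.log_nonpos hx.1 hx.2.le]
    have hg := ((hasSum_geometric_of_lt_one (sq_nonneg x) (by nlinarith [hx.2])).mul_left (1-x)).mul_left (-Real.log x)
    have e2 : ∀ n : ℕ, x^(2*n) = (x^2)^n := fun n => by rw [pow_mul]
    simp_rw [e2]
    rw [← ENNReal.ofReal_tsum_of_nonneg (fun n => by positivity) hg.summable, hg.tsum_eq]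
    unfold wt ff
    rw [← ENNReal.ofReal_mul (by positivity), ← ENNReal.ofReal_mul (by positivity)]
    congr 1
    have : 1 - x^2 = (1-x)*(1+x) := by ring
    have h3 : 1 - x ≠ 0 := by linarith [hx.2]
    have h4 : 1 + x ≠ 0 := by linarith
    rw [this]
    field_simp
  rw [setLIntegral_congr_fun measurableSet_Ico e, lintegral_const_mul _ (by fun_prop), lintegral_tsum (fun n => by fun_prop)]
  simp_rw [lint_term]
  rw [← ENNReal.ofReal_tsum_of_nonneg _ sum_alt.summable, sum_alt.tsum_eq, ← ENNReal.ofReal_mul (by positivity)]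
  · congr 1
    unfold cR
    field_simp
  · intro n
    rw [sub_nonneg]
    apply one_div_le_one_div_of_le (by positivity)
    gcongr
    norm_num

lemma lint_ff2 : ∫⁻ x, ff x * ff x ∂gμ ≠ ∞ := by
  rw [lint_gμ (fun x => ff x * ff x) (ff_meas.mul ff_meas)]
  have hl := log2_pos
  have e : ∀ x ∈ Ioo (0:ℝ) 1, wt x * (ff x * ff x) ≤ ENNReal.ofReal (16/Real.log 2 * (1 / √x)) := by
    intro x hx
    have hx0 := hx.1
    have hl0 : 0 ≤ - Real.log x := by linarith [Real.log_nonpos hx.1.le hx.2.le]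
    unfold wt ff
    rw [← ENNReal.ofReal_mul hl0, ← ENNReal.ofReal_mul (by positivity)]
    apply ENNReal.ofReal_le_ofReal
    set s := √(√x) with hs
    have hs0 : 0 < s := by positivity
    have hs2 : s^2 = √x := Real.sq_sqrt (by positivity)
    have hs4 : s^4 = x := by
      rw [show s^4 = (s^2)^2 by ring, hs2, Real.sq_sqrt hx0.le]
    have e1 : - Real.log x = 4 * Real.log (1/s) := by
      rw [← hs4, Real.log_pow, one_div, Real.log_inv]; push_cast; ring
    have e2 : - Real.log x ≤ 4 * (1/s) := by
      rw [e1]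
      have := Real.log_le_sub_one_of_pos (show 0 < 1/s by positivity)
      linarith
    have e3 : -Real.log x * -Real.log x ≤ (4 * (1/s)) * (4*(1/s)) := by
      apply mul_le_mul e2 e2 hl0; positivity
    have e4 : 1 / (Real.log 2 * (1+x)) ≤ 1 / Real.log 2 := by
      apply one_div_le_one_div_of_le hl
      nlinarith
    calc _ ≤ 1 / Real.log 2 * ((4 * (1/s)) * (4*(1/s))) := by
          apply mul_le_mul e4 e3 (by positivity) (by positivity)
      _ = _ := by rw [← hs2]; field_simp; norm_num
  have ee : volume.restrict (Ico (0:ℝ) 1) = volume.restrict (Ioo (0:ℝ) 1) := 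
    (Measure.restrict_congr_set Ioo_ae_eq_Ico).symm
  have h2 := lint_ftc (fun x => 16/Real.log 2 * (2 * √x)) (fun x => 16/Real.log 2 * (1/√x)) (by fun_prop) ?_ ?_
  · rw [ee] at h2 ⊢
    refine ne_top_of_le_ne_top ?_ (setLIntegral_mono' measurableSet_Ioo e)
    rw [h2]; exact ENNReal.ofReal_ne_top
  · intro x hx
    have hx0 := hx.1
    have := ((Real.hasDerivAt_sqrt hx.1.ne').const_mul 2).const_mul (16/Real.log 2)
    refine this.congr_deriv ?_
    field_simp
  · intro x hx
    have hx0 := hx.1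
    positivity

lemma gμ_ae : ∀ᵐ x ∂gμ, x ∈ Ico (0:ℝ) 1 := 
  (withDensity_absolutelyContinuous _ _).ae_le (ae_restrict_mem measurableSet_Ico)

lemma ae_gμ {p : ℝ → Prop} (h : ∀ᵐ x ∂gμ, p x) : ∀ᵐ x ∂(volume.restrict (Ico (0:ℝ) 1)), p x := by
  refine (withDensity_absolutelyContinuous' wt_meas.aemeasurable ?_).ae_le h
  filter_upwards [ae_restrict_mem measurableSet_Ico] with x hx
  have hl := log2_pos
  have : 0 < 1 + x := by linarith [hx.1]
  unfold wt
  simp only [ne_eq, ENNReal.ofReal_eq_zero, not_le]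
  positivity

lemma lint_inv (F : ℝ → ℝ≥0∞) (hF : Measurable F) (n : ℕ) : ∫⁻ x, F (gaussMap^[n] x) ∂gμ = ∫⁻ x, F x ∂gμ := by
  induction n with
  | zero => rfl
  | succ n ih =>
    rw [← ih]
    have := gauss_dual (fun x => F (gaussMap^[n] x)) (fun _ => 1) (hF.comp (gauss_meas.iterate n)) measurable_const
    simp only [mul_one] at this
    simp only [Function.iterate_succ_apply]
    rw [this]
    refine lintegral_congr_ae ?_
    filter_upwards [gμ_ae] with x hx
    rw [gU_const 1 x hx.1, mul_one]

lemma gU_iter_meas (g : ℝ → ℝ≥0∞) (hg : Measurable g) (n : ℕ) : Measurable (gU^[n] g) := by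
  induction n generalizing g with
  | zero => exact hg
  | succ n ih => exact ih _ (gU_meas g hg)

lemma lint_gU_iter (n : ℕ) : ∫⁻ x, (gU^[n] ff) x ∂gμ = ENNReal.ofReal cR := by
  have := gauss_dual_iter (fun _ => 1) measurable_const n ff ff_meas
  simp only [one_mul] at this
  rw [← this, lint_ff]

lemma osc0 : Osc (gU ff) (2 * ENNReal.ofReal cR) := by
  have hm := gU_mono ff ff_anti
  have h0 : gU ff 0 ≤ ENNReal.ofReal cR := by
    have := lint_gU_iter 1
    rw [← this]
    calc gU ff 0 = ∫⁻ _, gU ff 0 ∂gμ := by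
          have := lintegral_const_mul (μ := gμ) (gU ff 0) (f := fun _ => 1) measurable_const
          rw [lint_one] at this
          simpa using this.symm
      _ ≤ _ := by
          refine lintegral_mono_ae ?_
          filter_upwards [gμ_ae] with x hx
          exact hm (by simp) (Ico_subset_Icc_self hx) hx.1
  have id := gU_ident ff
  rw [ff_one, zero_add] at id
  have h1 : gU ff 1 ≤ 2 * ENNReal.ofReal cR := by
    rw [← id]; gcongr
  refine ⟨⟨ne_top_of_le_ne_top ENNReal.ofReal_ne_top h0, ne_top_of_le_ne_top (by finiteness) h1⟩, Or.inr ⟨hm, ?_⟩⟩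
  exact h1.trans le_add_self

lemma oscn (n : ℕ) : Osc (gU^[n+1] ff) (2 * ENNReal.ofReal cR * (2⁻¹)^n) := by
  induction n with
  | zero => simpa using osc0
  | succ n ih =>
    have := Osc_step _ _ ih
    rw [Function.iterate_succ_apply', pow_succ, ← mul_assoc]
    exact this

lemma gU_iter_le (n : ℕ) (x : ℝ) (hx : x ∈ Icc (0:ℝ) 1) : 
    (gU^[n+1] ff) x ≤ ENNReal.ofReal cR + 2 * ENNReal.ofReal cR * (2⁻¹)^n := by
  have hc : ∀ a : ℝ≥0∞, ∫⁻ _, a ∂gμ = a := by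
    intro a
    have := lintegral_const_mul (μ := gμ) a (f := fun _ => 1) measurable_const
    rw [lint_one] at this
    simpa using this
  rw [← hc ((gU^[n+1] ff) x)]
  calc _ ≤ ∫⁻ y, ((gU^[n+1] ff) y + 2 * ENNReal.ofReal cR * (2⁻¹)^n) ∂gμ := by
        refine lintegral_mono_ae ?_
        filter_upwards [gμ_ae] with y hy
        exact Osc_le _ _ (oscn n) x y hx (Ico_subset_Icc_self hy)
    _ = _ := by
        rw [lintegral_add_right _ measurable_const, hc, lint_gU_iter]

lemma corr (n : ℕ) : ∫⁻ x, ff (gaussMap^[n+1] x) * ff x ∂gμ ≤ 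
    ENNReal.ofReal cR * (ENNReal.ofReal cR + 2 * ENNReal.ofReal cR * (2⁻¹)^n) := by
  rw [gauss_dual_iter ff ff_meas (n+1) ff ff_meas, ← lint_ff, ← lintegral_mul_const _ ff_meas, lint_ff]
  refine lintegral_mono_ae ?_
  filter_upwards [gμ_ae] with x hx
  gcongr
  exact gU_iter_le n x (Ico_subset_Icc_self hx)

noncomputable def SS (n : ℕ) (x : ℝ) : ℝ≥0∞ := ∑ i ∈ Finset.range n, ff (gaussMap^[i] x)

lemma SS_meas (n : ℕ) : Measurable (SS n) := by
  unfold SS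
  exact Finset.measurable_sum _ fun i _ => ff_meas.comp (gauss_meas.iterate i)

lemma SS_succ (n : ℕ) (x : ℝ) : SS (n+1) x = SS n (gaussMap x) + ff x := by
  unfold SS
  rw [Finset.sum_range_succ']
  rfl

lemma SS_top (n : ℕ) (x : ℝ) : SS n x ≠ ∞ := by
  unfold SS
  exact ENNReal.sum_ne_top.2 fun i _ => ff_top _

lemma lint_SS (n : ℕ) : ∫⁻ x, SS n x ∂gμ = n * ENNReal.ofReal cR := by
  unfold SS
  rw [lintegral_finsetSum (f := fun i x => ff (gaussMap^[i] x)) _ fun i _ => ff_meas.comp (gauss_meas.iterate i)]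
  simp_rw [lint_inv ff ff_meas, lint_ff]
  simp

noncomputable def KK : ℝ≥0∞ := ∫⁻ x, ff x * ff x ∂gμ + 8 * ENNReal.ofReal cR ^ 2

lemma KK_top : KK ≠ ∞ := by
  unfold KK
  have := lint_ff2
  finiteness

lemma cross (n : ℕ) : ∫⁻ x, SS n (gaussMap x) * ff x ∂gμ ≤ n * ENNReal.ofReal cR ^ 2 + 4 * ENNReal.ofReal cR ^ 2 := by
  have e : ∀ x, SS n (gaussMap x) * ff x = ∑ i ∈ Finset.range n, ff (gaussMap^[i+1] x) * ff x := by
    intro x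
    unfold SS
    rw [Finset.sum_mul]; rfl
  simp_rw [e]
  rw [lintegral_finsetSum (f := fun i x => ff (gaussMap^[i+1] x) * ff x) _ fun i _ => (ff_meas.comp (gauss_meas.iterate (i+1))).mul ff_meas]
  set c := ENNReal.ofReal cR
  calc _ ≤ ∑ i ∈ Finset.range n, (c * (c + 2 * c * (2⁻¹)^i)) := Finset.sum_le_sum fun i _ => corr i
    _ = n * c^2 + 2 * c^2 * ∑ i ∈ Finset.range n, (2⁻¹ : ℝ≥0∞)^i := by
        simp_rw [mul_add]
        rw [Finset.sum_add_distrib, Finset.mul_sum]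
        congr 1
        · simp; ring
        · refine Finset.sum_congr rfl fun i _ => by ring
    _ ≤ n * c^2 + 2 * c^2 * 2 := by
        gcongr
        refine (ENNReal.sum_le_tsum _).trans ?_
        rw [ENNReal.tsum_geometric, ENNReal.one_sub_inv_two, inv_inv]
    _ = _ := by ring

lemma second (n : ℕ) : ∫⁻ x, SS n x * SS n x ∂gμ ≤ n^2 * ENNReal.ofReal cR ^ 2 + n * KK := by
  induction n with
  | zero => simp [SS]
  | succ n ih =>
    set c := ENNReal.ofReal cR with hc
    have e : ∀ x, SS (n+1) x * SS (n+1) x = SS n (gaussMap x) * SS n (gaussMap x) + 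
        (2 * (SS n (gaussMap x) * ff x) + ff x * ff x) := by
      intro x; rw [SS_succ]; ring
    simp_rw [e]
    have m1 : Measurable (fun x => SS n (gaussMap x)) := (SS_meas n).comp gauss_meas
    have m2 := ff_meas
    rw [lintegral_add_left (by fun_prop), lintegral_add_right _ (by fun_prop), lintegral_const_mul _ (by fun_prop)]
    have i1 := lint_inv (fun x => SS n x * SS n x) ((SS_meas n).mul (SS_meas n)) 1
    simp only [Function.iterate_one] at i1
    rw [i1]
    calc _ ≤ (n^2 * c^2 + n * KK) + (2 * (n * c^2 + 4 * c^2) + ∫⁻ x, ff x * ff x ∂gμ) := by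
          gcongr; exact cross n
      _ = (n^2 + 2 * n) * c^2 + n * KK + KK := by unfold KK; rw [← hc]; ring
      _ ≤ (n^2 + 2 * n + 1) * c^2 + n * KK + KK := by exact add_le_add (add_le_add (mul_le_mul_left le_self_add _) le_rfl) le_rfl
      _ = _ := by push_cast; ring

lemma variance (n : ℕ) : ∫⁻ x, ENNReal.ofReal (((SS n x).toReal - n * cR)^2) ∂gμ ≤ n * KK := by
  have hcp := cR_pos
  set c := ENNReal.ofReal cR with hc
  have e : ∀ x, ENNReal.ofReal (((SS n x).toReal - n * cR)^2) + 2 * n * c * SS n x = SS n x * SS n x + n^2 * c^2 := by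
    intro x
    have hs : SS n x = ENNReal.ofReal (SS n x).toReal := (ENNReal.ofReal_toReal (SS_top n x)).symm
    set s := (SS n x).toReal with hs'
    have hs0 : 0 ≤ s := ENNReal.toReal_nonneg
    have e1 : (2 * n * c * SS n x) = ENNReal.ofReal (2 * n * cR * s) := by
      rw [ENNReal.ofReal_mul (by positivity), ENNReal.ofReal_mul (by positivity), ENNReal.ofReal_mul (by positivity), ← hs, hc]
      simp
    have e2 : SS n x * SS n x = ENNReal.ofReal (s * s) := by
      rw [ENNReal.ofReal_mul hs0, ← hs]
    have e3 : n^2 * c^2 = ENNReal.ofReal (n^2 * cR^2) := by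
      rw [ENNReal.ofReal_mul (by positivity), ENNReal.ofReal_pow hcp.le, ENNReal.ofReal_pow (by positivity)]
      simp [hc]
    rw [e1, e2, e3, ← ENNReal.ofReal_add (by positivity) (by positivity), ← ENNReal.ofReal_add (by positivity) (by positivity)]
    congr 1
    ring
  have I := lintegral_congr (μ := gμ) e
  have m1 := SS_meas n
  rw [lintegral_add_right _ (m1.const_mul _), lintegral_const_mul _ m1, lint_SS, lintegral_add_right _ measurable_const] at I
  have hone : ∫⁻ _, (n:ℝ≥0∞)^2 * c^2 ∂gμ = n^2 * c^2 := by
    have := lintegral_const_mul (μ := gμ) ((n:ℝ≥0∞)^2 * c^2) (f := fun _ => 1) measurable_const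
    rw [lint_one] at this
    simpa using this
  rw [hone] at I
  have hfin : 2 * n * c * (n * c) ≠ ∞ := by finiteness
  refine (ENNReal.add_le_add_iff_right hfin).1 ?_
  rw [I]
  calc _ ≤ (n^2 * c^2 + n * KK) + n^2 * c^2 := by gcongr; exact second n
    _ = _ := by ring

lemma SS_log (x : ℝ) (hx : x ∈ Ico (0:ℝ) 1) (hirr : Irrational x) (n : ℕ) : 
    (SS n x).toReal = - Real.log (P x n) := by
  unfold SS P
  rw [ENNReal.toReal_sum fun i _ => ff_top _, Real.log_prod]
  · rw [← Finset.sum_neg_distrib]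
    refine Finset.sum_congr rfl fun i _ => ?_
    unfold ff
    have := gauss_iter_mem x hx i
    rw [ENNReal.toReal_ofReal]
    linarith [Real.log_nonpos this.1 this.2.le]
  · intro i _
    exact (gauss_iter_irr x hirr i).ne_zero

lemma sub_conv : ∀ᵐ x ∂gμ, Tendsto (fun n : ℕ => (SS ((n+1)^2) x).toReal / (((n+1)^2 : ℕ):ℝ)) atTop (nhds cR) := by
  have key : ∀ᵐ x ∂gμ, ∑' n : ℕ, ENNReal.ofReal (((SS ((n+1)^2) x).toReal / (((n+1)^2 : ℕ):ℝ) - cR)^2) < ∞ := by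
    apply ae_lt_top
    · refine Measurable.tsum fun n => ?_
      have := SS_meas ((n+1)^2)
      fun_prop
    · rw [lintegral_tsum (fun n => by have := SS_meas ((n+1)^2); fun_prop)]
      have hb : ∀ n : ℕ, ∫⁻ x, ENNReal.ofReal (((SS ((n+1)^2) x).toReal / (((n+1)^2 : ℕ):ℝ) - cR)^2) ∂gμ ≤ 
          ENNReal.ofReal (1/((n+1:ℕ):ℝ)^2) * KK := by
        intro n
        set N : ℕ := (n+1)^2 with hN
        have hN0 : (0:ℝ) < N := by rw [hN]; positivity
        have e : ∀ x, ENNReal.ofReal (((SS N x).toReal / (N:ℝ) - cR)^2) = 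
            ENNReal.ofReal (1/(N:ℝ)^2) * ENNReal.ofReal (((SS N x).toReal - N * cR)^2) := by
          intro x
          rw [← ENNReal.ofReal_mul (by positivity)]
          congr 1
          field_simp
        simp_rw [e]
        rw [lintegral_const_mul _ (by have := SS_meas N; fun_prop)]
        calc _ ≤ ENNReal.ofReal (1/(N:ℝ)^2) * (N * KK) := by gcongr; exact variance N
          _ = ENNReal.ofReal (1/(N:ℝ)^2 * N) * KK := by
            rw [ENNReal.ofReal_mul (by positivity), ENNReal.ofReal_natCast, mul_assoc]
          _ = _ := by
            congr 2
            rw [show ((n+1:ℕ):ℝ)^2 = (N:ℝ) by rw [hN]; push_cast; ring]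
            field_simp
      refine ne_top_of_le_ne_top ?_ (ENNReal.tsum_le_tsum hb)
      rw [ENNReal.tsum_mul_right]
      refine ENNReal.mul_ne_top ?_ KK_top
      have hs : Summable (fun n : ℕ => 1/((n+1:ℕ):ℝ)^2) := 
        (summable_nat_add_iff 1 (f := fun n : ℕ => 1/(n:ℝ)^2)).2 hasSum_zeta_two.summable
      rw [← ENNReal.ofReal_tsum_of_nonneg (fun n => by positivity) hs]
      exact ENNReal.ofReal_ne_top
  filter_upwards [key] with x hx
  have h0 := ENNReal.tendsto_atTop_zero_of_tsum_ne_top hx.ne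
  have h1 := (ENNReal.tendsto_toReal ENNReal.zero_ne_top).comp h0
  simp only [Function.comp_def, ENNReal.toReal_zero] at h1
  have h2 : Tendsto (fun n : ℕ => ((SS ((n+1)^2) x).toReal / (((n+1)^2 : ℕ):ℝ) - cR)^2) atTop (nhds 0) := by
    refine h1.congr fun n => ENNReal.toReal_ofReal (sq_nonneg _)
  have h3 := h2.sqrt
  simp only [Real.sqrt_sq_eq_abs, Real.sqrt_zero] at h3
  have h4 := (tendsto_zero_iff_abs_tendsto_zero _).2 h3
  have h5 := h4.add_const cR
  simpa using h5

lemma full_conv : ∀ᵐ x ∂gμ, Tendsto (fun n : ℕ => (SS n x).toReal / (n:ℝ)) atTop (nhds cR) := by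
  filter_upwards [sub_conv] with x hx
  refine tendsto_div_of_monotone_of_exists_subseq_tendsto_div (fun n => (SS n x).toReal) cR ?_ ?_
  · intro m n hmn
    refine ENNReal.toReal_mono (SS_top n x) ?_
    unfold SS
    exact Finset.sum_le_sum_of_subset (Finset.range_mono hmn)
  · intro a ha
    refine ⟨fun n => (n+1)^2, ?_, ?_, hx⟩
    · have h1 : Tendsto (fun n : ℕ => (1 + 1/((n:ℝ)+1))^2) atTop (nhds ((1+0)^2)) := 
        (tendsto_const_nhds.add tendsto_one_div_add_atTop_nhds_zero_nat).pow 2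
      have h2 := h1.eventually_lt_const (show (1+0:ℝ)^2 < a by simpa using ha)
      filter_upwards [h2] with n hn
      have hp : (0:ℝ) < (n:ℝ)+1 := by positivity
      push_cast
      calc ((n:ℝ)+1+1)^2 = (1 + 1/((n:ℝ)+1))^2 * ((n:ℝ)+1)^2 := by field_simp
        _ ≤ a * ((n:ℝ)+1)^2 := by gcongr
    · exact (tendsto_pow_atTop (by norm_num)).comp (tendsto_add_atTop_nat 1)

lemma irr_ae : ∀ᵐ x : ℝ, Irrational x := by
  have : (Set.range ((↑) : ℚ → ℝ)).Countable := Set.countable_range _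
  have h := this.measure_zero volume
  exact measure_eq_zero_iff_ae_notMem.1 h

end KN

theorem kn_over_n_limit (β : ℝ) (hβ : 1 < β) :
    ∀ᵐ x ∂(volume.restrict (Set.Ico (0:ℝ) 1)),
      Tendsto (fun n : ℕ => (kCF β n x : ℝ) / n) atTop
        (nhds (6 * Real.log 2 * Real.log β / Real.pi ^ 2)) := by
  filter_upwards [KN.beta_ae β hβ, KN.ae_gμ KN.full_conv, ae_restrict_mem measurableSet_Ico, 
    ae_restrict_of_ae KN.irr_ae] with x h1 h2 h3 h4
  have h := KN.final_limit β hβ x h3 h4 KN.cR KN.cR_pos (by simpa only [KN.SS_log x h3 h4] using h2) h1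
  have e : Real.log β / (2 * KN.cR) = 6 * Real.log 2 * Real.log β / Real.pi ^ 2 := by
    have := KN.log2_pos
    have := Real.pi_pos
    unfold KN.cR
    field_simp
    ring
  rwa [e] at h
end

section
/- Let β > 1 and let x ∈ [0,1) be irrational. Then for every n ≥ 1, the length of the β-expansion cylinder of order n containing x satisfies 1/(6·q_{k_n(x)+3}(x)²) ≤ |J(ε_1(x),…,ε_n(x))| ≤ 1/q_{k_n(x)}(x)². -/
open MeasureTheory Filter Set

lemma gm_irr (x : ℝ) (hx : x ∈ Set.Ico (0:ℝ) 1) (hirr : Irrational x) (i : ℕ) :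
    gaussMap^[i] x ∈ Set.Ico (0:ℝ) 1 ∧ Irrational (gaussMap^[i] x) := by
  induction i with
  | zero => exact ⟨hx, hirr⟩
  | succ i ih =>
    rw [Function.iterate_succ_apply']
    obtain ⟨h1, h2⟩ := ih
    have h0 : gaussMap^[i] x ≠ 0 := h2.ne_zero
    simp only [gaussMap, h0, if_false]
    refine ⟨⟨?_, ?_⟩, ?_⟩
    · linarith [Int.floor_le (1 / gaussMap^[i] x)]
    · linarith [Int.lt_floor_add_one (1 / gaussMap^[i] x)]
    · rw [one_div]
      exact (h2.inv).sub_intCast _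

lemma gm_mem (y : ℝ) (hy : y ∈ Set.Ico (0:ℝ) 1) (i : ℕ) :
    gaussMap^[i] y ∈ Set.Ico (0:ℝ) 1 := by
  induction i with
  | zero => exact hy
  | succ i ih =>
    rw [Function.iterate_succ_apply']
    by_cases h0 : gaussMap^[i] y = 0
    · simp [gaussMap, h0]
    · simp only [gaussMap, h0, if_false]
      constructor
      · linarith [Int.floor_le (1 / gaussMap^[i] y)]
      · linarith [Int.lt_floor_add_one (1 / gaussMap^[i] y)]

lemma cfA_pos (x : ℝ) (hx : x ∈ Set.Ico (0:ℝ) 1) (hirr : Irrational x) (i : ℕ) :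
    1 ≤ cfA i x := by
  obtain ⟨h1, h2⟩ := gm_irr x hx hirr (i - 1)
  have h0 : gaussMap^[i - 1] x ≠ 0 := h2.ne_zero
  have hp : 0 < gaussMap^[i - 1] x := lt_of_le_of_ne h1.1 (Ne.symm h0)
  unfold cfA
  rw [Int.le_floor, le_div_iff₀ hp]
  push_cast
  linarith [h1.2]

/-- shifted denominators -/
noncomputable def qq (x : ℝ) : ℕ → ℝ
  | 0 => 0
  | (n + 1) => (cfQ x n : ℝ)

/-- the signed linear forms in `y` -/
noncomputable def GG (x y : ℝ) : ℕ → ℝ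
  | 0 => 1
  | 1 => y
  | (n + 2) => GG x y n - (cfA (n + 1) x : ℝ) * GG x y (n + 1)

lemma qq_rec (x : ℝ) (n : ℕ) :
    qq x (n + 2) = (cfA (n + 1) x : ℝ) * qq x (n + 1) + qq x n := by
  cases n with
  | zero => simp [qq, cfQ]
  | succ n => simp [qq, cfQ]

lemma GG_rec (x y : ℝ) (n : ℕ) :
    GG x y (n + 2) = GG x y n - (cfA (n + 1) x : ℝ) * GG x y (n + 1) := rfl

lemma qq_nonneg (x : ℝ) (hx : x ∈ Set.Ico (0:ℝ) 1) (hirr : Irrational x) (n : ℕ) :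
    0 ≤ qq x n ∧ qq x n ≤ qq x (n + 1) ∧ 1 ≤ qq x (n + 1) := by
  induction n with
  | zero => simp [qq, cfQ]
  | succ n ih =>
    obtain ⟨h1, h2, h3⟩ := ih
    have ha : (1:ℝ) ≤ (cfA (n + 1) x : ℝ) := by exact_mod_cast cfA_pos x hx hirr (n + 1)
    rw [show n + 1 + 1 = n + 2 from rfl, qq_rec]
    refine ⟨by linarith, by nlinarith, by nlinarith⟩

lemma qq_ge (x : ℝ) (hx : x ∈ Set.Ico (0:ℝ) 1) (hirr : Irrational x) (n : ℕ) :
    (n : ℝ) ≤ qq x (n + 1) := by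
  induction n with
  | zero => simp [qq, cfQ]
  | succ n ih =>
    rcases n with _ | n
    · have := (qq_nonneg x hx hirr 1).2.2
      simpa using this
    have ha : (1:ℝ) ≤ (cfA (n + 1 + 1) x : ℝ) := by exact_mod_cast cfA_pos x hx hirr (n + 1 + 1)
    have := (qq_nonneg x hx hirr n).2.2
    have := (qq_nonneg x hx hirr (n+1)).2.2
    rw [show n + 1 + 1 + 1 = n + 1 + 2 from rfl, qq_rec]
    push_cast at ih ⊢
    nlinarith

lemma GG_det (x y : ℝ) (m : ℕ) :
    GG x y m * qq x (m + 1) + GG x y (m + 1) * qq x m = 1 := by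
  induction m with
  | zero => simp [qq, cfQ, GG]
  | succ m ih =>
    rw [show m + 1 + 1 = m + 2 from rfl, qq_rec, GG_rec]
    linarith

lemma GG_lin (x y z : ℝ) (m : ℕ) :
    GG x y m - GG x z m = - (-1) ^ m * qq x m * (y - z) := by
  have : (GG x y m - GG x z m = - (-1) ^ m * qq x m * (y - z)) ∧
      (GG x y (m+1) - GG x z (m+1) = - (-1) ^ (m+1) * qq x (m+1) * (y - z)) := by
    induction m with
    | zero => simp [qq, cfQ, GG]
    | succ m ih =>
      refine ⟨ih.2, ?_⟩
      rw [show m + 1 + 1 = m + 2 from rfl, qq_rec, GG_rec, GG_rec]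
      have h1 := ih.1
      have h2 := ih.2
      rw [pow_succ] at h2
      rw [pow_add]
      linear_combination h1 - (cfA (m + 1) x : ℝ) * h2
  exact this.1

lemma cyl_succ (x y : ℝ) (m : ℕ) :
    y ∈ cfCyl (m + 1) x ↔ y ∈ cfCyl m x ∧ cfA (m + 1) y = cfA (m + 1) x := by
  constructor
  · rintro ⟨h, h'⟩
    exact ⟨⟨h, fun i hi hi' => h' i hi (by omega)⟩, h' _ (by omega) le_rfl⟩
  · rintro ⟨⟨h, h'⟩, h2⟩
    refine ⟨h, fun i hi hi' => ?_⟩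
    rcases Nat.lt_or_ge i (m + 1) with h3 | h3
    · exact h' i hi (by omega)
    · rw [show i = m + 1 by omega]; exact h2

lemma lemA (x : ℝ) (hx : x ∈ Set.Ico (0:ℝ) 1) (hirr : Irrational x) (y : ℝ) (m : ℕ)
    (hy : y ∈ cfCyl m x) :
    0 < GG x y m ∧ GG x y (m + 1) = gaussMap^[m] y * GG x y m := by
  induction m with
  | zero => simp [GG]
  | succ m ih =>
    rw [cyl_succ] at hy
    obtain ⟨h1, h2⟩ := ih hy.1
    have ha := cfA_pos x hx hirr (m + 1)
    have hm := gm_mem y hy.1.1 m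
    have h0 : gaussMap^[m] y ≠ 0 := by
      intro h
      rw [← hy.2] at ha
      simp [cfA, h] at ha
    have hp : 0 < gaussMap^[m] y := lt_of_le_of_ne hm.1 (Ne.symm h0)
    refine ⟨by rw [h2]; positivity, ?_⟩
    rw [show m + 1 + 1 = m + 2 from rfl, GG_rec, Function.iterate_succ_apply', ← hy.2]
    simp only [gaussMap, h0, if_false, cfA, Nat.add_sub_cancel]
    rw [h2]
    field_simp

lemma lemB (x : ℝ) (hx : x ∈ Set.Ico (0:ℝ) 1) (hirr : Irrational x) (y : ℝ) (m : ℕ)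
    (h1 : 0 < GG x y (m + 1)) (h2 : GG x y (m + 1) < GG x y m) : y ∈ cfCyl m x := by
  induction m with
  | zero =>
    simp [GG] at h1 h2
    exact ⟨⟨h1.le, h2⟩, fun i hi hi' => by omega⟩
  | succ m ih =>
    rw [show m + 1 + 1 = m + 2 from rfl, GG_rec] at h1 h2
    have ha : (1:ℝ) ≤ (cfA (m + 1) x : ℝ) := by exact_mod_cast cfA_pos x hx hirr (m + 1)
    have h3 : 0 < GG x y (m + 1) := by linarith
    have hc := ih h3 (by nlinarith)
    rw [cyl_succ]
    refine ⟨hc, ?_⟩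
    obtain ⟨h4, h5⟩ := lemA x hx hirr y m hc
    have hp : 0 < gaussMap^[m] y := by
      by_contra hneg
      nlinarith
    simp only [cfA, Nat.add_sub_cancel] at *
    rw [Int.floor_eq_iff]
    rw [le_div_iff₀ hp, div_lt_iff₀ hp]
    rw [h5] at h1 h2
    constructor
    · by_contra hneg
      nlinarith
    · by_contra hneg
      nlinarith

lemma cyl_diam (x : ℝ) (hx : x ∈ Set.Ico (0:ℝ) 1) (hirr : Irrational x) (y z : ℝ) (m : ℕ)
    (hy : y ∈ cfCyl m x) (hz : z ∈ cfCyl m x) : |y - z| ≤ 1 / (cfQ x m : ℝ) ^ 2 := by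
  obtain ⟨hq0, -, hq1⟩ := qq_nonneg x hx hirr m
  have key : ∀ w ∈ cfCyl m x, 0 ≤ GG x w (m + 1) ∧ GG x w (m + 1) * qq x (m + 1) ≤ 1 := by
    intro w hw
    obtain ⟨h1, h2⟩ := lemA x hx hirr w m hw
    have hm := gm_mem w hw.1 m
    have h3 : 0 ≤ GG x w (m + 1) := by rw [h2]; exact mul_nonneg hm.1 h1.le
    have h4 : GG x w (m + 1) ≤ GG x w m := by rw [h2]; nlinarith [hm.2]
    have := GG_det x w m
    exact ⟨h3, by nlinarith⟩
  have hl := GG_lin x y z (m + 1)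
  have hl2 : |GG x y (m + 1) - GG x z (m + 1)| = qq x (m + 1) * |y - z| := by
    rw [hl, abs_mul, abs_mul, abs_neg, abs_pow, abs_neg, abs_one, one_pow, one_mul,
      abs_of_nonneg (by linarith : 0 ≤ qq x (m + 1))]
  obtain ⟨a1, a2⟩ := key y hy
  obtain ⟨b1, b2⟩ := key z hz
  change |y - z| ≤ 1 / (qq x (m + 1)) ^ 2
  rw [le_div_iff₀ (by positivity)]
  have h5 : |GG x y (m + 1) - GG x z (m + 1)| * qq x (m + 1) ≤ 1 := by
    rcases abs_cases (GG x y (m + 1) - GG x z (m + 1)) with h | h <;> rw [h.1] <;> nlinarith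
  rw [hl2] at h5
  nlinarith

lemma dist_lower (x : ℝ) (hx : x ∈ Set.Ico (0:ℝ) 1) (hirr : Irrational x) (y : ℝ) (m : ℕ)
    (hy : y ∉ cfCyl m x) : 1 / (6 * (cfQ x (m + 2) : ℝ) ^ 2) ≤ |y - x| := by
  have hG : ∀ i, 0 < GG x x i ∧ GG x x (i + 1) ≤ GG x x i := by
    intro i
    obtain ⟨h1, h2⟩ := lemA x hx hirr x i ⟨hx, fun _ _ _ => rfl⟩
    have hm := gm_mem x hx i
    exact ⟨h1, by rw [h2]; nlinarith [hm.2]⟩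
  have hl : ∀ i, |GG x y i - GG x x i| = qq x i * |y - x| := by
    intro i
    rw [GG_lin, abs_mul, abs_mul, abs_neg, abs_pow, abs_neg, abs_one, one_pow, one_mul,
      abs_of_nonneg (qq_nonneg x hx hirr i).1]
  obtain ⟨q0, q1, q2⟩ := qq_nonneg x hx hirr m
  obtain ⟨-, q3, -⟩ := qq_nonneg x hx hirr (m + 1)
  obtain ⟨-, q4, -⟩ := qq_nonneg x hx hirr (m + 2)
  simp only [add_assoc, Nat.reduceAdd] at q3 q4
  change 1 / (6 * (qq x (m + 3)) ^ 2) ≤ |y - x|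
  have hN : 1 ≤ qq x (m + 3) := by linarith
  rw [div_le_iff₀ (by positivity)]
  have d0 := abs_nonneg (y - x)
  have or1 : GG x y (m + 1) ≤ 0 ∨ GG x y m ≤ GG x y (m + 1) := by
    by_contra hcon
    push Not at hcon
    exact hy (lemB x hx hirr y m hcon.1 hcon.2)
  have D1 := GG_det x x (m + 1)
  have D2 := GG_det x x (m + 2)
  simp only [add_assoc, Nat.reduceAdd] at D1 D2
  have g1 := hG (m + 1)
  have g2 := hG (m + 2)
  simp only [add_assoc, Nat.reduceAdd] at g1 g2
  have hl0 := hl m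
  have hl1 := hl (m + 1)
  generalize |y - x| = d at *
  rcases or1 with h | h
  · have e1 : GG x x (m + 1) ≤ qq x (m + 1) * d := by
      rw [← hl1]; linarith [neg_abs_le (GG x y (m + 1) - GG x x (m + 1))]
    have e2 : 1 ≤ GG x x (m + 1) * (2 * qq x (m + 3)) := by nlinarith
    have e3 : GG x x (m + 1) ≤ qq x (m + 3) * d := by nlinarith
    nlinarith [mul_le_mul_of_nonneg_right e3 (by linarith : 0 ≤ 2 * qq x (m + 3)), sq_nonneg (qq x (m+3))]
  · have e1 : GG x x m - GG x x (m + 1) ≤ (qq x m + qq x (m + 1)) * d := by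
      rw [add_mul, ← hl0, ← hl1]
      linarith [le_abs_self (GG x y (m + 1) - GG x x (m + 1)),
        neg_abs_le (GG x y m - GG x x m)]
    have ha : (1:ℝ) ≤ (cfA (m + 1) x : ℝ) := by exact_mod_cast cfA_pos x hx hirr (m + 1)
    have e0 : GG x x (m + 2) ≤ GG x x m - GG x x (m + 1) := by
      rw [GG_rec]; nlinarith
    have e2 : 1 ≤ GG x x (m + 2) * (2 * qq x (m + 3)) := by nlinarith
    have e3 : GG x x (m + 2) ≤ 2 * qq x (m + 3) * d := by nlinarith
    nlinarith [mul_le_mul_of_nonneg_right e3 (by linarith : 0 ≤ 2 * qq x (m + 3)), mul_nonneg (sq_nonneg (qq x (m+3))) d0]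

lemma betaCyl_iter (β : ℝ) (hβ : 1 < β) (n : ℕ) (x y z w : ℝ) (hy : y ∈ betaCyl β n x)
    (hw : w ∈ betaCyl β n x) (h1 : y ≤ z) (h2 : z ≤ w) (i : ℕ) (hi : i ≤ n) :
    (betaT β)^[i] y ≤ (betaT β)^[i] z ∧ (betaT β)^[i] z ≤ (betaT β)^[i] w ∧
    ∀ j, 1 ≤ j → j ≤ i → betaEps β j z = betaEps β j x := by
  induction i with
  | zero => exact ⟨h1, h2, fun j _ _ => by omega⟩
  | succ i ih =>
    obtain ⟨a, b, c⟩ := ih (by omega)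
    have e1 := hy.2 (i + 1) (by omega) hi
    have e2 := hw.2 (i + 1) (by omega) hi
    simp only [betaEps, Nat.add_sub_cancel] at e1 e2
    have m1 : β * (betaT β)^[i] y ≤ β * (betaT β)^[i] z := by nlinarith
    have m2 : β * (betaT β)^[i] z ≤ β * (betaT β)^[i] w := by nlinarith
    have f1 := Int.floor_mono m1
    have f2 := Int.floor_mono m2
    have e3 : ⌊β * (betaT β)^[i] z⌋ = ⌊β * (betaT β)^[i] x⌋ := by omega
    simp only [Function.iterate_succ_apply', betaT] at *
    rw [e1, e2, e3]
    refine ⟨by linarith, by linarith, fun j hj hj' => ?_⟩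
    rcases Nat.lt_or_ge j (i + 1) with h3 | h3
    · exact c j hj (by omega)
    · rw [show j = i + 1 by omega]
      simpa [betaEps] using e3

lemma betaCyl_ordConnected (β : ℝ) (hβ : 1 < β) (n : ℕ) (x : ℝ) :
    (betaCyl β n x).OrdConnected := by
  constructor
  intro y hy w hw z hz
  exact ⟨⟨hy.1.1.trans hz.1, hz.2.trans_lt hw.1.2⟩,
    (betaCyl_iter β hβ n x y z w hy hw hz.1 hz.2 n le_rfl).2.2⟩

lemma betaCyl_right (β : ℝ) (hβ : 1 < β) (n : ℕ) (x : ℝ) (hx : x ∈ Set.Ico (0:ℝ) 1) :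
    ∃ z, x < z ∧ z ∈ betaCyl β n x := by
  have key : ∃ δ > 0, ∀ z, x ≤ z → z < x + δ →
      (betaT β)^[n] z - (betaT β)^[n] x = β ^ n * (z - x) ∧
      ∀ j, 1 ≤ j → j ≤ n → betaEps β j z = betaEps β j x := by
    induction n with
    | zero => exact ⟨1, one_pos, fun z _ _ => ⟨by simp, fun j _ _ => by omega⟩⟩
    | succ n ih =>
      obtain ⟨δ, hδ, H⟩ := ih
      set t := β * (betaT β)^[n] x with ht
      have hpow : 0 < β ^ (n + 1) := by positivity
      have hs : 0 < (⌊t⌋ + 1 - t) / β ^ (n + 1) :=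
        div_pos (by linarith [Int.lt_floor_add_one t]) hpow
      refine ⟨min δ ((⌊t⌋ + 1 - t) / β ^ (n + 1)), lt_min hδ hs, fun z hz1 hz2 => ?_⟩
      have hz3 : z < x + δ := hz2.trans_le (by gcongr; exact min_le_left _ _)
      have hz4 : z - x < (⌊t⌋ + 1 - t) / β ^ (n + 1) := by
        linarith [min_le_right δ ((⌊t⌋ + 1 - t) / β ^ (n + 1))]
      rw [lt_div_iff₀ hpow] at hz4
      obtain ⟨a, b⟩ := H z hz1 hz3
      have e : β * (betaT β)^[n] z - t = β ^ (n + 1) * (z - x) := by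
        rw [ht, pow_succ]; linear_combination β * a
      have e0 : 0 ≤ β ^ (n + 1) * (z - x) := mul_nonneg hpow.le (by linarith)
      have e3 : ⌊β * (betaT β)^[n] z⌋ = ⌊t⌋ := by
        rw [Int.floor_eq_iff]
        constructor
        · linarith [Int.floor_le t]
        · linarith
      have hT : ∀ u, betaT β u = β * u - ⌊β * u⌋ := fun u => rfl
      rw [Function.iterate_succ_apply', Function.iterate_succ_apply', hT, hT ((betaT β)^[n] x)]
      refine ⟨by rw [e3, ← ht]; linarith, fun j hj hj' => ?_⟩
      rcases Nat.lt_or_ge j (n + 1) with h3 | h3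
      · exact b j hj (by omega)
      · rw [show j = n + 1 by omega]
        exact e3
  obtain ⟨δ, hδ, H⟩ := key
  have hm : 0 < min δ (1 - x) := lt_min hδ (by linarith [hx.2])
  have := min_le_left δ (1 - x)
  have := min_le_right δ (1 - x)
  refine ⟨x + min δ (1 - x) / 2, by linarith, ⟨by linarith [hx.1], by linarith [hx.2]⟩, ?_⟩
  exact (H _ (by linarith) (by linarith)).2

lemma kCF_spec (β : ℝ) (hβ : 1 < β)
    (x : ℝ) (hx : x ∈ Set.Ico (0:ℝ) 1) (hirr : Irrational x) (n : ℕ) :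
    betaCyl β n x ⊆ cfCyl (kCF β n x) x ∧ ¬ betaCyl β n x ⊆ cfCyl (kCF β n x + 1) x := by
  have hb : BddAbove {m | betaCyl β n x ⊆ cfCyl m x} := by
    obtain ⟨z, hz1, hz2⟩ := betaCyl_right β hβ n x hx
    refine ⟨⌊1 / (z - x)⌋₊, fun m hm => ?_⟩
    apply Nat.le_floor
    have h := cyl_diam x hx hirr z x m (hm hz2) ⟨hx, fun _ _ _ => rfl⟩
    have hp : 0 < z - x := by linarith
    have hq1 := (qq_nonneg x hx hirr m).2.2
    have hq2 := qq_ge x hx hirr m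
    change |z - x| ≤ 1 / (qq x (m + 1)) ^ 2 at h
    rw [abs_of_pos hp, le_div_iff₀ (by positivity)] at h
    rw [le_div_iff₀ hp]
    nlinarith [mul_le_mul_of_nonneg_right hq2 hp.le]
  have hne : {m | betaCyl β n x ⊆ cfCyl m x}.Nonempty :=
    ⟨0, fun y hy => ⟨hy.1, fun i _ _ => by omega⟩⟩
  refine ⟨Nat.sSup_mem hne hb, fun h => ?_⟩
  have := le_csSup hb (show kCF β n x + 1 ∈ {m | betaCyl β n x ⊆ cfCyl m x} from h)
  change kCF β n x + 1 ≤ kCF β n x at this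
  omega

theorem cylinder_length_vs_q_kn (β : ℝ) (hβ : 1 < β)
    (x : ℝ) (hx : x ∈ Set.Ico (0:ℝ) 1) (hirr : Irrational x) (n : ℕ) (hn : 1 ≤ n) :
    1 / (6 * (cfQ x (kCF β n x + 3) : ℝ) ^ 2) ≤ (volume (betaCyl β n x)).toReal ∧
    (volume (betaCyl β n x)).toReal ≤ 1 / (cfQ x (kCF β n x) : ℝ) ^ 2 := by
  obtain ⟨h1, h2⟩ := kCF_spec β hβ x hx hirr n
  have hxJ : x ∈ betaCyl β n x := ⟨hx, fun _ _ _ => rfl⟩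
  have hfin : volume (betaCyl β n x) ≠ ⊤ := by
    refine ne_top_of_le_ne_top ?_ (measure_mono (fun y hy => hy.1 : betaCyl β n x ⊆ Set.Ico 0 1))
    simp
  constructor
  · rw [Set.not_subset] at h2
    obtain ⟨y, hyJ, hy⟩ := h2
    have hd := dist_lower x hx hirr y (kCF β n x + 1) hy
    refine hd.trans ?_
    have hsub : Set.uIcc x y ⊆ betaCyl β n x :=
      (betaCyl_ordConnected β hβ n x).uIcc_subset hxJ hyJ
    have := ENNReal.toReal_mono hfin (measure_mono (μ := volume) hsub)
    rw [Real.volume_interval, ENNReal.toReal_ofReal (abs_nonneg _)] at this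
    exact this
  · have hq : (0:ℝ) ≤ 1 / (cfQ x (kCF β n x) : ℝ) ^ 2 := by positivity
    refine ENNReal.toReal_le_of_le_ofReal hq ?_
    refine (Real.volume_le_diam _).trans ?_
    refine Metric.ediam_le fun y hy z hz => ?_
    rw [edist_dist, Real.dist_eq]
    exact ENNReal.ofReal_le_ofReal (cyl_diam x hx hirr y z _ (h1 hy) (h1 hz))
end
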